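/- arXiv:2210.04059 — 11 statements merged into one kernel-verified Lean document; each statement's English description precedes it below -/
import Mathlib

section
/- Consider the ProbeTop-k linear program polytope: fix positive integers n, J, k, T and numbers q_{ij} ∈ [0,1] for i ∈ {1,…,n}, j ∈ {1,…,J}, and let P ⊆ ℝ^{n×J} × ℝ^n be the set of pairs (x, y) satisfying 0 ≤ x_{ij} ≤ y_i q_{ij} for all i, j; Σ_{i=1}^n y_i ≤ T; Σ_{i=1}^n Σ_{j=1}^J x_{ij} ≤ k; and 0 ≤ y_i ≤ 1 for all i. Then every extreme point (x, y) of P has at most two indices i with y_i ∉ {0,1}; moreover, if there are exactly two such indices i₁ ≠ i₂, then y_{i₁} + y_{i₂} = 1. -/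
open Finset

/-- An extreme point admits no nonzero direction along which one can move both ways. -/
theorem eq_zero_of_eventually_add_smul_mem {E : Type*} [AddCommGroup E] [Module ℝ E]
    {P : Set E} {z d : E} (hz : z ∈ Set.extremePoints ℝ P)
    (h : ∀ᶠ t : ℝ in nhds 0, z + t • d ∈ P) : d = 0 := by
  obtain ⟨r, hr, hball⟩ := Metric.eventually_nhds_iff.1 h
  have hpos : z + (r / 2) • d ∈ P := hball (by
    rw [Real.dist_eq, sub_zero, abs_of_pos (by positivity)]; linarith)
  have hneg : z + (-(r / 2)) • d ∈ P := hball (by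
    rw [Real.dist_eq, sub_zero, abs_neg, abs_of_pos (by positivity)]; linarith)
  have hseg : z ∈ openSegment ℝ (z + (r / 2) • d) (z + (-(r / 2)) • d) :=
    ⟨1 / 2, 1 / 2, by norm_num, by norm_num, by norm_num, by module⟩
  have hzd := (mem_extremePoints.1 hz).2 _ hpos _ hneg hseg
  have hsmul : (r / 2) • d = 0 := by simpa using hzd.1
  exact (smul_eq_zero.1 hsmul).resolve_left (by positivity)

/-- More vectors than the dimension satisfy a nontrivial linear relation. -/
theorem exists_relation_supported_on {ι V : Type*} [Fintype ι] [AddCommGroup V] [Module ℝ V]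
    [FiniteDimensional ℝ V] (S : Finset ι) (v : ι → V) (h : Module.finrank ℝ V < S.card) :
    ∃ c : ι → ℝ, (∀ i ∉ S, c i = 0) ∧ ∑ i, c i • v i = 0 ∧ ∃ i, c i ≠ 0 := by
  classical
  have hdep : ¬ LinearIndepOn ℝ v (S : Set ι) := fun hli => by
    have hcard := LinearIndependent.fintype_card_le_finrank hli
    simp only [Finset.coe_sort_coe, Fintype.card_coe] at hcard
    omega
  rw [linearIndepOn_finset_iff] at hdep
  push Not at hdep
  obtain ⟨f, hf, i, hi, hfi⟩ := hdep
  refine ⟨fun i => if i ∈ S then f i else 0, fun i hi => if_neg hi, ?_, i, by simpa [hi] using hfi⟩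
  simpa [ite_smul, Finset.sum_ite_mem] using hf

/-- At an extreme point of the ProbeTop-k polytope, no relative perturbation of the rows with
fractional `y i` keeps the tight budget constraints tight. -/
theorem relative_perturbation_eq_zero {ι κ : Type*} [Fintype ι] [Fintype κ] {q : ι → κ → ℝ}
    {T k : ℝ} {x : ι → κ → ℝ} {y : ι → ℝ}
    (hxy : (x, y) ∈ Set.extremePoints ℝ {xy : (ι → κ → ℝ) × (ι → ℝ) |
      (∀ i j, 0 ≤ xy.1 i j ∧ xy.1 i j ≤ xy.2 i * q i j) ∧
      (∑ i, xy.2 i ≤ T) ∧ (∑ i, ∑ j, xy.1 i j ≤ k) ∧ (∀ i, 0 ≤ xy.2 i ∧ xy.2 i ≤ 1)})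
    {c : ι → ℝ} (hc : ∀ i, c i ≠ 0 → y i ≠ 0 ∧ y i ≠ 1)
    (hcx : ∑ i, c i * ∑ j, x i j = 0) (hcy : ∑ i, c i * y i = 0 ∨ ∑ i, y i < T) :
    ∀ i, c i = 0 := by
  obtain ⟨hx, hT, hk, hy⟩ := hxy.1
  dsimp only at hx hT hk hy
  have hd : ((fun i j => c i * x i j, fun i => c i * y i) : (ι → κ → ℝ) × (ι → ℝ)) = 0 := by
    refine eq_zero_of_eventually_add_smul_mem hxy ?_
    have hscale : ∀ᶠ t : ℝ in nhds 0, ∀ i, 0 < 1 + t * c i :=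
      Filter.eventually_all.2 fun i =>
        ContinuousAt.eventually_lt (by fun_prop) (by fun_prop) (by simp)
    have hone : ∀ᶠ t : ℝ in nhds 0, ∀ i, y i + t * (c i * y i) ≤ 1 := by
      refine Filter.eventually_all.2 fun i => ?_
      by_cases hci : c i = 0
      · simpa [hci] using (hy i).2
      · refine (ContinuousAt.eventually_lt (by fun_prop) (by fun_prop) ?_).mono fun t => le_of_lt
        simpa using lt_of_le_of_ne (hy i).2 (hc i hci).2
    have hbudget : ∀ᶠ t : ℝ in nhds 0, ∑ i, y i + t * ∑ i, c i * y i ≤ T := by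
      rcases hcy with h0 | hlt
      · simpa [h0] using hT
      · refine (ContinuousAt.eventually_lt (by fun_prop) (by fun_prop) ?_).mono fun t => le_of_lt
        simpa using hlt
    filter_upwards [hscale, hone, hbudget] with t hpos hle hsum
    refine ⟨fun i j => ?_, ?_, ?_, fun i => ⟨?_, hle i⟩⟩
    · have h0 := mul_nonneg (hpos i).le (hx i j).1
      have h1 := mul_le_mul_of_nonneg_left (hx i j).2 (hpos i).le
      simp only [Prod.fst_add, Prod.snd_add, Prod.smul_fst, Prod.smul_snd, Pi.add_apply,
        Pi.smul_apply, smul_eq_mul]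
      constructor <;> linarith
    · simpa [Finset.sum_add_distrib, ← Finset.mul_sum] using hsum
    · simpa [Finset.sum_add_distrib, ← Finset.mul_sum, hcx] using hk
    · have h0 := mul_nonneg (hpos i).le (hy i).1
      simp only [Prod.snd_add, Prod.smul_snd, Pi.add_apply, Pi.smul_apply, smul_eq_mul]
      linarith
  intro i
  by_contra hci
  have hcyi : c i * y i = 0 := congrFun (congrArg Prod.snd hd) i
  exact (mul_ne_zero hci (hc i hci).1) hcyi

/-- **ProbeTop-k LP basic feasible solutions (Lemma: bfs2).**
Every extreme point `(x, y)` of the ProbeTop-k LP polytope has at most two indices `i`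
with `y i ∉ {0,1}`, and if there are two distinct such indices then their `y`-values sum to 1. -/
theorem stmt0 (n J k T : ℕ) (hn : 0 < n) (hJ : 0 < J) (hk : 0 < k) (hT : 0 < T)
    (q : Fin n → Fin J → ℝ) (hq : ∀ i j, q i j ∈ Set.Icc (0:ℝ) 1)
    (P : Set ((Fin n → Fin J → ℝ) × (Fin n → ℝ)))
    (hP : P = {xy | (∀ i j, 0 ≤ xy.1 i j ∧ xy.1 i j ≤ xy.2 i * q i j) ∧
      (∑ i, xy.2 i ≤ (T:ℝ)) ∧ (∑ i, ∑ j, xy.1 i j ≤ (k:ℝ)) ∧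
      (∀ i, 0 ≤ xy.2 i ∧ xy.2 i ≤ 1)})
    (x : Fin n → Fin J → ℝ) (y : Fin n → ℝ)
    (hxy : (x, y) ∈ Set.extremePoints ℝ P) :
    {i : Fin n | y i ≠ 0 ∧ y i ≠ 1}.ncard ≤ 2 ∧
      (∀ i₁ i₂ : Fin n, i₁ ≠ i₂ → (y i₁ ≠ 0 ∧ y i₁ ≠ 1) → (y i₂ ≠ 0 ∧ y i₂ ≠ 1) →
        y i₁ + y i₂ = 1) := by
  classical
  subst hP
  have hy := hxy.1.2.2.2
  have hyT := hxy.1.2.1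
  dsimp only at hy hyT
  have hcard : {i : Fin n | y i ≠ 0 ∧ y i ≠ 1}.ncard ≤ 2 := by
    by_contra! hcard
    rw [Set.ncard_eq_toFinset_card'] at hcard
    obtain ⟨c, hcS, hsum, i, hi⟩ := exists_relation_supported_on
      {i : Fin n | y i ≠ 0 ∧ y i ≠ 1}.toFinset (fun i => (∑ j, x i j, y i)) (by simpa using hcard)
    have hsum' : ∑ i, c i * ∑ j, x i j = 0 ∧ ∑ i, c i * y i = 0 := by
      simpa [Prod.ext_iff, Prod.fst_sum, Prod.snd_sum] using hsum
    refine hi (relative_perturbation_eq_zero hxy (fun i hci => ?_) hsum'.1 (.inl hsum'.2) i)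
    simpa using mt (hcS i) hci
  refine ⟨hcard, fun a b hab ha hb => ?_⟩
  have htight : ∑ i, y i = T := by
    refine hyT.eq_of_not_lt fun hlt => ?_
    obtain ⟨c, hcS, hsum, i, hi⟩ := exists_relation_supported_on {a, b}
      (fun i => ∑ j, x i j) (by simp [Finset.card_pair hab])
    refine hi (relative_perturbation_eq_zero hxy (fun i hci => ?_) hsum (.inr hlt) i)
    have hmem : i ∈ ({a, b} : Finset (Fin n)) := by_contra fun h => hci (hcS i h)
    rcases Finset.mem_insert.1 hmem with rfl | h
    · exact ha
    · exact Finset.mem_singleton.1 h ▸ hb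
  have hrest : ∀ i ∈ ({a, b} : Finset (Fin n))ᶜ, y i = ((if y i = 1 then 1 else 0 : ℤ) : ℝ) := by
    intro i hi
    have hfrac : {a, b} = {i : Fin n | y i ≠ 0 ∧ y i ≠ 1} := by
      refine Set.eq_of_subset_of_ncard_le ?_ (by rwa [Set.ncard_pair hab])
      rintro i (rfl | rfl) <;> assumption
    have hnot : i ∉ {i : Fin n | y i ≠ 0 ∧ y i ≠ 1} := by
      rw [← hfrac]
      simpa using hi
    by_cases h1 : y i = 1
    · simp [h1]
    · simpa [h1] using hnot
  have hsplit := Finset.sum_add_sum_compl {a, b} y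
  rw [Finset.sum_pair hab, Finset.sum_congr rfl hrest, ← Int.cast_sum, htight] at hsplit
  set m : ℤ := ∑ i ∈ ({a, b} : Finset (Fin n))ᶜ, if y i = 1 then 1 else 0
  have hint : y a + y b = ((T - m : ℤ) : ℝ) := by
    push_cast
    linarith
  have hpos : 0 < y a + y b :=
    add_pos (lt_of_le_of_ne (hy a).1 ha.1.symm) (lt_of_le_of_ne (hy b).1 hb.1.symm)
  have hlt : y a + y b < 1 + 1 :=
    add_lt_add (lt_of_le_of_ne (hy a).2 ha.2) (lt_of_le_of_ne (hy b).2 hb.2)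
  rw [hint] at hpos hlt ⊢
  norm_cast at hpos hlt ⊢
  omega
end

section
/- Fix positive integers n, k, weights v_1 ≥ v_2 ≥ ⋯ ≥ v_n ≥ 0, probabilities p_1,…,p_n ∈ [0,1], and a vector y ∈ [0,1]^n having exactly two fractional components i₁ < i₂ (all other components lie in {0,1}) with y_{i₁} + y_{i₂} = 1. Let P_1,…,P_n be independent Bernoulli random variables with P(P_i = 1) = p_i. Let Y ∈ {0,1}^n be the random vector, independent of (P_1,…,P_n), with Y_i = y_i for the integer components, and (Y_{i₁}, Y_{i₂}) = (1,0) with probability y_{i₁} and (0,1) with probability y_{i₂}. Let Ỹ_1,…,Ỹ_n be independent Bernoulli random variables with means y_1,…,y_n, independent of (P_1,…,P_n). Define Z_i = Y_i P_i, N_j = Σ_{ℓ=1}^{j} Z_ℓ, Z̃_i = Ỹ_i P_i, and Ñ_j = min{k, Σ_{ℓ=1}^{j} Z̃_ℓ}. Then Σ_{i=1}^n v_i E[Z_i · 1{N_{i−1} < k}] ≥ Σ_{i=1}^n v_i E[Z̃_i · 1{Ñ_{i−1} < k}], where N_0 = Ñ_0 = 0. -/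
open Finset

/-- The probability that the set of `1`-coordinates of a vector of independent Bernoulli
random variables with means `p` equals exactly `A`. -/
noncomputable def bernWeight {n : ℕ} (p : Fin n → ℝ) (A : Finset (Fin n)) : ℝ :=
  (∏ i ∈ A, p i) * ∏ i ∈ Aᶜ, (1 - p i)

/-- Indicator (as a real number) of the event `Z_i = 1` and `N_{i-1} < k`, where `Z` is the
set of candidates that are on the interview list and would be hired upon interview, and
`N_{i-1}` counts such candidates preceding `i`. -/
def hireIndic {n : ℕ} (k : ℕ) (Z : Finset (Fin n)) (i : Fin n) : ℝ :=
  if i ∈ Z ∧ (Z.filter (fun ℓ => ℓ < i)).card < k then 1 else 0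

/-- Indicator (as a real number) of `Z̃_i = 1` and `Ñ_{i-1} = min(k, ·) < k`. -/
def hireIndicMin {n : ℕ} (k : ℕ) (Z : Finset (Fin n)) (i : Fin n) : ℝ :=
  if i ∈ Z ∧ min k (Z.filter (fun ℓ => ℓ < i)).card < k then 1 else 0

theorem sum_mul_last_le_of_prefix_nonneg (n : ℕ) (v d : Fin (n + 1) → ℝ) (hv : Antitone v)
    (hd : ∀ m : ℕ, 0 ≤ ∑ i with i.val < m, d i) :
    v (Fin.last n) * ∑ i, d i ≤ ∑ i, v i * d i := by
  induction n with
  | zero => simp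
  | succ n ih =>
    have key : ∀ m : ℕ, m ≤ n + 1 →
        ∑ i : Fin (n + 1) with i.val < m, d i.castSucc = ∑ i with i.val < m, d i := by
      intro m hm
      simp only [Finset.sum_filter]
      rw [Fin.sum_univ_castSucc (n := n + 1)]
      simp [hm]
    have hall : ∀ m : ℕ, n + 1 ≤ m →
        ∑ i : Fin (n + 1) with i.val < m, d i.castSucc = ∑ i : Fin (n + 1), d i.castSucc := by
      intro m hm
      rw [Finset.filter_true_of_mem]
      intro i _
      omega
    have h0 : 0 ≤ ∑ i : Fin (n + 1), d i.castSucc := by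
      rw [← hall (n + 1) le_rfl, key (n + 1) le_rfl]
      exact hd _
    have h1 := ih (fun i => v i.castSucc) (fun i => d i.castSucc)
      (fun i j hij => hv (Fin.castSucc_le_castSucc_iff.mpr hij)) (by
        intro m
        rcases le_total m (n + 1) with hm | hm
        · rw [key m hm]
          exact hd m
        · rw [hall m hm]
          exact h0)
    have h2 : v (Fin.last (n + 1)) ≤ v (Fin.last n).castSucc := hv (Fin.le_last _)
    rw [Fin.sum_univ_castSucc (n := n + 1), Fin.sum_univ_castSucc (n := n + 1), mul_add]
    have h3 := mul_le_mul_of_nonneg_right h2 h0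
    linarith

/-- Abel's inequality: a nonnegative decreasing weighting of a sequence with nonnegative partial
sums has nonnegative total. -/
theorem sum_mul_nonneg_of_prefix_nonneg {n : ℕ} (v d : Fin n → ℝ) (hv : Antitone v)
    (hv0 : ∀ i, 0 ≤ v i) (hd : ∀ m : ℕ, 0 ≤ ∑ i with i.val < m, d i) :
    0 ≤ ∑ i, v i * d i := by
  cases n with
  | zero => simp
  | succ n =>
    refine le_trans (mul_nonneg (hv0 (Fin.last n)) ?_)
      (sum_mul_last_le_of_prefix_nonneg n v d hv hd)
    have h := hd (n + 1)
    rwa [Finset.filter_true_of_mem (fun i _ => i.isLt)] at h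

theorem sum_hireIndic_prefix {n : ℕ} (k : ℕ) (Z : Finset (Fin n)) (m : ℕ) :
    ∑ i with i.val < m, hireIndic k Z i = (min k (Z.filter (fun i => i.val < m)).card : ℕ) := by
  induction m with
  | zero => simp
  | succ m ih =>
    by_cases hm : m < n
    · let a : Fin n := ⟨m, hm⟩
      have e : ∀ T : Finset (Fin n), T.filter (fun i => i.val < m + 1) =
          T.filter (fun i => i.val < m) ∪ T.filter (fun i => i = a) := by
        intro T
        ext i
        simp only [Finset.mem_filter, Finset.mem_union, Fin.ext_iff, a, ← and_or_left]
        exact and_congr_right fun _ => by omega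
      have dj : ∀ T : Finset (Fin n),
          Disjoint (T.filter (fun i => i.val < m)) (T.filter (fun i => i = a)) := by
        intro T
        rw [Finset.disjoint_filter]
        rintro i _ h rfl
        simp [a] at h
      rw [e, e, Finset.sum_union (dj _), Finset.card_union_of_disjoint (dj _), ih,
        Finset.filter_eq', Finset.filter_eq']
      have hlt : Z.filter (fun ℓ => ℓ < a) = Z.filter (fun i => i.val < m) := rfl
      simp only [Finset.mem_univ, if_true, Finset.sum_singleton, hireIndic, hlt]
      by_cases ha : a ∈ Z
      · by_cases hc : (Z.filter (fun i => i.val < m)).card < k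
        · simp only [ha, hc, and_self, if_true, Finset.card_singleton]
          rw [min_eq_right hc.le, min_eq_right hc]
          push_cast
          ring
        · simp only [ha, hc, and_false, if_false, if_true, Finset.card_singleton, add_zero]
          rw [min_eq_left (by omega), min_eq_left (by omega)]
      · simp [ha]
    · have e : ∀ T : Finset (Fin n), T.filter (fun i => i.val < m + 1) =
          T.filter (fun i => i.val < m) := by
        intro T
        exact Finset.filter_congr fun i _ => by omega
      rw [e, e, ih]

/-- The value of the first `k` elements of a list. -/
def hireValue {n : ℕ} (v : Fin n → ℝ) (k : ℕ) (Z : Finset (Fin n)) : ℝ :=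
  ∑ i, v i * hireIndic k Z i

/-- Diminishing returns of the value of the `k` best candidates. -/
theorem hireValue_submodular {n : ℕ} {v : Fin n → ℝ} (hv : Antitone v) (hv0 : ∀ i, 0 ≤ v i)
    (k : ℕ) {Z : Finset (Fin n)} {a b : Fin n} (ha : a ∉ Z) (hb : b ∉ Z) (hab : a ≠ b) :
    hireValue v k Z + hireValue v k (insert a (insert b Z)) ≤
      hireValue v k (insert a Z) + hireValue v k (insert b Z) := by
  have h := sum_mul_nonneg_of_prefix_nonneg v
    (fun i => hireIndic k (insert a Z) i + hireIndic k (insert b Z) i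
      - hireIndic k Z i - hireIndic k (insert a (insert b Z)) i) hv hv0 (by
    intro m
    simp only [Finset.sum_sub_distrib, Finset.sum_add_distrib, sum_hireIndic_prefix]
    have hc : ∀ (T : Finset (Fin n)) (c : Fin n), c ∉ T →
        ((insert c T).filter (fun i => i.val < m)).card =
          (T.filter (fun i => i.val < m)).card + if c.val < m then 1 else 0 := by
      intro T c hcT
      rw [Finset.filter_insert]
      split_ifs with h
      · rw [Finset.card_insert_of_notMem (fun h' => hcT (Finset.mem_filter.mp h').1)]
      · rfl
    rw [hc (insert b Z) a (by simp [ha, hab]), hc Z a ha, hc Z b hb]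
    generalize (Z.filter (fun i => i.val < m)).card = c
    rw [sub_sub, sub_nonneg]
    norm_cast
    split_ifs <;> omega)
  simp only [mul_sub, mul_add, Finset.sum_sub_distrib, Finset.sum_add_distrib] at h
  unfold hireValue
  linarith

theorem hireValue_inter_submodular {n : ℕ} {v : Fin n → ℝ} (hv : Antitone v)
    (hv0 : ∀ i, 0 ≤ v i) (k : ℕ) {Z : Finset (Fin n)} {a b : Fin n} (ha : a ∉ Z) (hb : b ∉ Z)
    (hab : a ≠ b) (A : Finset (Fin n)) :
    hireValue v k (Z ∩ A) + hireValue v k (insert a (insert b Z) ∩ A) ≤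
      hireValue v k (insert a Z ∩ A) + hireValue v k (insert b Z ∩ A) := by
  by_cases hA : a ∈ A <;> by_cases hB : b ∈ A <;>
    simp only [Finset.insert_inter_of_mem, Finset.insert_inter_of_notMem, hA, hB,
      not_false_eq_true]
  · exact hireValue_submodular hv hv0 k (by simp [ha]) (by simp [hb]) hab
  · exact (add_comm _ _).le
  · exact le_rfl
  · exact le_rfl

theorem bernWeight_eq_prod {n : ℕ} (p : Fin n → ℝ) (A : Finset (Fin n)) :
    bernWeight p A = ∏ i, if i ∈ A then p i else 1 - p i := by
  rw [bernWeight, ← Finset.prod_mul_prod_compl A]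
  congr 1
  · exact Finset.prod_congr rfl fun i hi => by simp [hi]
  · exact Finset.prod_congr rfl fun i hi => by simp [Finset.mem_compl.mp hi]

theorem bernWeight_nonneg {n : ℕ} {p : Fin n → ℝ} (hp : ∀ i, p i ∈ Set.Icc (0 : ℝ) 1)
    (A : Finset (Fin n)) : 0 ≤ bernWeight p A :=
  mul_nonneg (Finset.prod_nonneg fun i _ => (hp i).1)
    (Finset.prod_nonneg fun i _ => sub_nonneg.mpr (hp i).2)

/-- Expectation under independent rounding of a vector with at most two fractional coordinates. -/
theorem sum_bernWeight_mul_of_two_fractional {n : ℕ} {y : Fin n → ℝ} {a b : Fin n} (hab : a ≠ b)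
    {B : Finset (Fin n)} (ha : a ∉ B) (hb : b ∉ B) (h1 : ∀ i ∈ B, y i = 1)
    (h0 : ∀ i ∉ B, i ≠ a → i ≠ b → y i = 0) (G : Finset (Fin n) → ℝ) :
    ∑ S, bernWeight y S * G S =
      (1 - y a) * (1 - y b) * G B + y a * (1 - y b) * G (insert a B)
        + (1 - y a) * y b * G (insert b B) + y a * y b * G (insert a (insert b B)) := by
  have hw : ∀ S : Finset (Fin n), (∀ i, i ≠ a → i ≠ b → (i ∈ S ↔ i ∈ B)) →
      bernWeight y S = (if a ∈ S then y a else 1 - y a) * (if b ∈ S then y b else 1 - y b) := by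
    intro S hS
    rw [bernWeight_eq_prod, ← Finset.prod_pair hab
      (f := fun i => if i ∈ S then y i else 1 - y i)]
    refine (Finset.prod_subset (Finset.subset_univ _) fun i _ hi => ?_).symm
    simp only [Finset.mem_insert, Finset.mem_singleton, not_or] at hi
    by_cases hB : i ∈ B
    · simp [hS i hi.1 hi.2, hB, h1 i hB]
    · simp [hS i hi.1 hi.2, hB, h0 i hB hi.1 hi.2]
  have hz : ∀ S : Finset (Fin n), (∃ i, i ≠ a ∧ i ≠ b ∧ ¬(i ∈ S ↔ i ∈ B)) →
      bernWeight y S = 0 := by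
    rintro S ⟨i, hia, hib, hi⟩
    rw [bernWeight_eq_prod]
    refine Finset.prod_eq_zero (Finset.mem_univ i) ?_
    by_cases hB : i ∈ B
    · have : i ∉ S := by tauto
      simp [this, h1 i hB]
    · have : i ∈ S := by tauto
      simp [this, h0 i hB hia hib]
  have hba : b ≠ a := hab.symm
  have hsub : ∑ S, bernWeight y S * G S =
      ∑ S ∈ {B, insert a B, insert b B, insert a (insert b B)}, bernWeight y S * G S := by
    refine (Finset.sum_subset (Finset.subset_univ _) fun S _ hS => ?_).symm
    rw [hz S, zero_mul]
    by_contra! hc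
    apply hS
    simp only [Finset.mem_insert, Finset.mem_singleton, Finset.ext_iff]
    by_cases hSa : a ∈ S <;> by_cases hSb : b ∈ S
    · refine Or.inr (Or.inr (Or.inr fun i => ?_))
      grind
    · refine Or.inr (Or.inl fun i => ?_)
      grind
    · refine Or.inr (Or.inr (Or.inl fun i => ?_))
      grind
    · refine Or.inl fun i => ?_
      grind
  have n1 : B ∉ ({insert a B, insert b B, insert a (insert b B)} : Finset (Finset (Fin n))) := by
    simp only [Finset.mem_insert, Finset.mem_singleton]
    grind
  have n2 : insert a B ∉ ({insert b B, insert a (insert b B)} : Finset (Finset (Fin n))) := by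
    have hb' : b ∉ insert a B := by simp [hb, hba]
    simp only [Finset.mem_insert, Finset.mem_singleton, not_or]
    exact ⟨fun h => hb' (h ▸ by simp), fun h => hb' (h ▸ by simp)⟩
  have n3 : insert b B ∉ ({insert a (insert b B)} : Finset (Finset (Fin n))) := by
    simp only [Finset.mem_singleton]
    grind
  rw [hsub, Finset.sum_insert n1, Finset.sum_insert n2, Finset.sum_insert n3,
    Finset.sum_singleton, hw B (by simp), hw (insert a B) (by simp +contextual),
    hw (insert b B) (by simp +contextual), hw (insert a (insert b B)) (by simp +contextual)]
  simp only [Finset.mem_insert, ha, hb, hab, hba, or_false, or_true, if_true, if_false]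
  ring

theorem hireIndicMin_eq_hireIndic {n : ℕ} (k : ℕ) (Z : Finset (Fin n)) (i : Fin n) :
    hireIndicMin k Z i = hireIndic k Z i := by
  simp [hireIndicMin, hireIndic]

theorem sum_mul_sum_bernWeight_mul_hireIndic {n : ℕ} (k : ℕ) (v p : Fin n → ℝ)
    (S : Finset (Fin n)) :
    ∑ i, v i * ∑ A : Finset (Fin n), bernWeight p A * hireIndic k (S ∩ A) i =
      ∑ A : Finset (Fin n), bernWeight p A * hireValue v k (S ∩ A) := by
  simp only [hireValue, Finset.mul_sum]
  rw [Finset.sum_comm]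
  exact Finset.sum_congr rfl fun _ _ => Finset.sum_congr rfl fun _ _ => by ring

/-- **Negatively correlated rounding beats independent rounding (Lemma: samplepath).**
With values sorted decreasingly, a fractional `y ∈ [0,1]^n` with exactly two fractional
coordinates `i₁ < i₂` summing to `1`, independent Bernoulli `P_i` with means `p i`,
the perfectly negatively correlated rounding `Y` of `y` (realizing the list `S₁` with
probability `y i₁` and `S₂` with probability `y i₂`) yields
`∑ i v_i E[Z_i 1{N_{i-1} < k}] ≥ ∑ i v_i E[Z̃_i 1{Ñ_{i-1} < k}]`, where `Z_i = Y_i P_i`,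
and `Z̃_i = Ỹ_i P_i` uses independent Bernoulli `Ỹ_i` with means `y i`. -/
theorem stmt2 (n k : ℕ) (hn : 0 < n) (hk : 0 < k)
    (v p y : Fin n → ℝ)
    (hvmono : ∀ i j : Fin n, i ≤ j → v j ≤ v i) (hv0 : ∀ i, 0 ≤ v i)
    (hp : ∀ i, p i ∈ Set.Icc (0:ℝ) 1) (hy : ∀ i, y i ∈ Set.Icc (0:ℝ) 1)
    (i₁ i₂ : Fin n) (h12 : i₁ < i₂)
    (h1 : y i₁ ≠ 0 ∧ y i₁ ≠ 1) (h2 : y i₂ ≠ 0 ∧ y i₂ ≠ 1)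
    (hint : ∀ i, i ≠ i₁ → i ≠ i₂ → y i = 0 ∨ y i = 1)
    (hsum : y i₁ + y i₂ = 1)
    (S₁ S₂ : Finset (Fin n))
    (hS₁ : ∀ i, i ∈ S₁ ↔ (y i = 1 ∨ i = i₁))
    (hS₂ : ∀ i, i ∈ S₂ ↔ (y i = 1 ∨ i = i₂)) :
    ∑ i, v i * (y i₁ * ∑ A : Finset (Fin n), bernWeight p A * hireIndic k (S₁ ∩ A) i
              + y i₂ * ∑ A : Finset (Fin n), bernWeight p A * hireIndic k (S₂ ∩ A) i)
    ≥ ∑ i, v i * ∑ SY : Finset (Fin n), ∑ A : Finset (Fin n),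
        bernWeight y SY * bernWeight p A * hireIndicMin k (SY ∩ A) i := by
  have hne := h12.ne
  set B : Finset (Fin n) := Finset.univ.filter (fun i => y i = 1) with hBdef
  have mB : ∀ i, i ∈ B ↔ y i = 1 := by simp [hBdef]
  have ha : i₁ ∉ B := fun h => h1.2 ((mB _).mp h)
  have hb : i₂ ∉ B := fun h => h2.2 ((mB _).mp h)
  have e₁ : S₁ = insert i₁ B := by
    ext i
    rw [hS₁, Finset.mem_insert, mB, or_comm]
  have e₂ : S₂ = insert i₂ B := by
    ext i
    rw [hS₂, Finset.mem_insert, mB, or_comm]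
  let G : Finset (Fin n) → ℝ := fun S => ∑ A, bernWeight p A * hireValue v k (S ∩ A)
  have hL : ∑ i, v i * (y i₁ * ∑ A : Finset (Fin n), bernWeight p A * hireIndic k (S₁ ∩ A) i
              + y i₂ * ∑ A : Finset (Fin n), bernWeight p A * hireIndic k (S₂ ∩ A) i)
      = y i₁ * G S₁ + y i₂ * G S₂ := by
    simp only [G, ← sum_mul_sum_bernWeight_mul_hireIndic]
    rw [Finset.mul_sum, Finset.mul_sum, ← Finset.sum_add_distrib]
    exact Finset.sum_congr rfl fun _ _ => by ring
  have hR : ∑ i, v i * ∑ SY : Finset (Fin n), ∑ A : Finset (Fin n),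
        bernWeight y SY * bernWeight p A * hireIndicMin k (SY ∩ A) i
      = ∑ S, bernWeight y S * G S := by
    simp only [G, ← sum_mul_sum_bernWeight_mul_hireIndic, hireIndicMin_eq_hireIndic, mul_assoc,
      ← Finset.mul_sum]
    simp only [Finset.mul_sum]
    rw [Finset.sum_comm]
    exact Finset.sum_congr rfl fun _ _ => Finset.sum_congr rfl fun _ _ =>
      Finset.sum_congr rfl fun _ _ => by ring
  have hsub : G B + G (insert i₁ (insert i₂ B)) ≤ G (insert i₁ B) + G (insert i₂ B) := by
    simp only [G, ← Finset.sum_add_distrib, ← mul_add]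
    exact Finset.sum_le_sum fun A _ => mul_le_mul_of_nonneg_left
      (hireValue_inter_submodular (fun i j hij => hvmono i j hij) hv0 k ha hb hne A)
      (bernWeight_nonneg hp A)
  rw [hL, hR, sum_bernWeight_mul_of_two_fractional hne ha hb (fun i hi => (mB i).mp hi)
    (fun i hi hi₁ hi₂ => (hint i hi₁ hi₂).resolve_right fun h => hi ((mB i).mpr h)) G, e₁, e₂]
  have hy₂ : y i₂ = 1 - y i₁ := by linarith
  have h := mul_le_mul_of_nonneg_left hsub (mul_nonneg (hy i₁).1 (hy i₂).1)
  rw [hy₂] at h ⊢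
  linarith
end

section
/- Fix positive integers n, k, T with k ≤ T ≤ n, probabilities p_1,…,p_n ∈ [0,1] and values v_1,…,v_n ≥ 0 (identical positions). Define LP_par as the supremum of Σ_{j=1}^k Σ_{i=1}^n v_i p_i y_{ij} over y ∈ [0,1]^{n×k} subject to Σ_{i=1}^n y_{ij} ≤ T for every j ∈ {1,…,k}, Σ_{i=1}^n y_{ij} p_i ≤ 1 for every j ∈ {1,…,k}, and Σ_{j=1}^k y_{ij} ≤ 1 for every i ∈ {1,…,n}. Define LP_seq as the supremum of Σ_{i=1}^n v_i p_i y_i over y ∈ [0,1]^n subject to Σ_{i=1}^n y_i ≤ kT and Σ_{i=1}^n y_i p_i ≤ k. Then LP_par = LP_seq. -/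
open Finset

/-- **LP equivalence between parallel and sequential offering (Lemma: cost_of_batching).**
For identical positions, the parallel-offering LP with `k` positions and `T` rounds has the
same value as the sequential-offering LP with `kT` offers. -/
theorem stmt5 (n k T : ℕ) (hk : 0 < k) (hkT : k ≤ T) (hTn : T ≤ n)
    (p v : Fin n → ℝ) (hp : ∀ i, p i ∈ Set.Icc (0:ℝ) 1) (hv : ∀ i, 0 ≤ v i) :
    sSup {z : ℝ | ∃ y : Fin n → Fin k → ℝ, (∀ i j, y i j ∈ Set.Icc (0:ℝ) 1) ∧
        (∀ j, ∑ i, y i j ≤ (T:ℝ)) ∧ (∀ j, ∑ i, y i j * p i ≤ 1) ∧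
        (∀ i, ∑ j, y i j ≤ 1) ∧ z = ∑ j, ∑ i, v i * p i * y i j}
      = sSup {z : ℝ | ∃ y : Fin n → ℝ, (∀ i, y i ∈ Set.Icc (0:ℝ) 1) ∧
        (∑ i, y i ≤ (k:ℝ) * (T:ℝ)) ∧ (∑ i, y i * p i ≤ (k:ℝ)) ∧
        z = ∑ i, v i * p i * y i} := by
  have hk0 : (0:ℝ) < k := Nat.cast_pos.mpr hk
  have hk1 : (1:ℝ) ≤ k := Nat.one_le_cast.mpr hk
  congr 1
  ext z
  constructor
  · rintro ⟨y, hy, hT, hP, h1, rfl⟩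
    refine ⟨fun i => ∑ j, y i j, fun i => ⟨sum_nonneg fun j _ => (hy i j).1, h1 i⟩, ?_, ?_, ?_⟩
    · rw [sum_comm]
      simpa using sum_le_sum fun j (_ : j ∈ univ) => hT j
    · simp only [sum_mul]
      rw [sum_comm]
      simpa using sum_le_sum fun j (_ : j ∈ univ) => hP j
    · simp only [mul_sum]
      exact sum_comm
  · rintro ⟨y, hy, hT, hP, rfl⟩
    refine ⟨fun i _ => y i / k, fun i _ => ⟨div_nonneg (hy i).1 hk0.le,
      (div_le_one hk0).mpr ((hy i).2.trans hk1)⟩, fun _ => ?_, fun _ => ?_, fun i => ?_, ?_⟩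
    · rw [← sum_div, div_le_iff₀ hk0]
      linarith
    · simp only [div_mul_eq_mul_div]
      rw [← sum_div]
      exact (div_le_one hk0).mpr hP
    · simpa [mul_div_cancel₀ _ hk0.ne'] using (hy i).2
    · simp only [← mul_div_assoc, ← sum_div, sum_const, card_univ, Fintype.card_fin, nsmul_eq_mul]
      field_simp
end

section
/- Fix a positive integer k, a positive integer n, probabilities p_1,…,p_n ∈ [0,1] and values v_1,…,v_n ≥ 0. Define LP_sim as the supremum over y ∈ [0,1]^n of Σ_{i=1}^n v_i p_i y_i + min(0, k − Σ_{i=1}^n p_i y_i). For S ⊆ {1,…,n}, with B_1,…,B_n independent Bernoulli random variables with P(B_i = 1) = p_i, define the simultaneous-offering reward R(S) := E[Σ_{i∈S} v_i B_i − max(Σ_{i∈S} B_i − k, 0)]. Then for every subset S ⊆ {1,…,n}, R(S) ≤ LP_sim. -/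
open Finset

/-- Expected reward of sending simultaneous offers to the set `S` with capacity `k`:
`E[∑_{i∈S} v_i B_i − max(∑_{i∈S} B_i − k, 0)]` for independent Bernoulli `B_i` of means `p i`. -/
noncomputable def simReward {n : ℕ} (k : ℕ) (p v : Fin n → ℝ) (S : Finset (Fin n)) : ℝ :=
  ∑ A : Finset (Fin n),
    bernWeight p A * ((∑ i ∈ S ∩ A, v i) - max (((S ∩ A).card : ℝ) - (k : ℝ)) 0)

theorem sum_bernWeight {n : ℕ} (p : Fin n → ℝ) : ∑ A : Finset (Fin n), bernWeight p A = 1 := by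
  have h := Finset.prod_add p (fun i => 1 - p i) univ
  simp only [add_sub_cancel, prod_const_one, powerset_univ, ← compl_eq_univ_sdiff] at h
  exact h.symm

theorem sum_bernWeight_mem {n : ℕ} (p : Fin n → ℝ) (i : Fin n) :
    ∑ A : Finset (Fin n), (if i ∈ A then bernWeight p A else 0) = p i := by
  have h := Finset.prod_add p (fun j => if j = i then 0 else 1 - p j) univ
  simp only [powerset_univ, ← compl_eq_univ_sdiff] at h
  rw [Finset.prod_eq_single_of_mem i (mem_univ i) (fun j _ hj => by simp [hj])] at h
  simp only [if_true, add_zero] at h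
  rw [h]
  refine sum_congr rfl fun A _ => ?_
  split_ifs with hA
  · unfold bernWeight
    congr 1
    refine prod_congr rfl fun j hj => ?_
    rw [if_neg]
    rintro rfl
    exact mem_compl.1 hj hA
  · exact (mul_eq_zero_of_right _ (prod_eq_zero (mem_compl.2 hA) (by simp))).symm

/-- Linearity of expectation for weighted sums of independent Bernoulli variables. -/
theorem sum_bernWeight_mul_sum_inter {n : ℕ} (p c : Fin n → ℝ) (S : Finset (Fin n)) :
    ∑ A : Finset (Fin n), bernWeight p A * ∑ i ∈ S ∩ A, c i = ∑ i ∈ S, c i * p i := by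
  simp_rw [← sum_ite_mem, mul_sum]
  rw [sum_comm]
  refine sum_congr rfl fun i _ => ?_
  rw [← sum_bernWeight_mem p i, mul_sum]
  refine sum_congr rfl fun A _ => ?_
  split_ifs <;> ring

theorem simReward_le {n : ℕ} (k : ℕ) {p : Fin n → ℝ} (hp : ∀ i, p i ∈ Set.Icc (0 : ℝ) 1)
    (v : Fin n → ℝ) (S : Finset (Fin n)) :
    simReward k p v S ≤ ∑ i ∈ S, v i * p i + min 0 ((k : ℝ) - ∑ i ∈ S, p i) := by
  have hv := sum_bernWeight_mul_sum_inter p v S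
  have hcard := sum_bernWeight_mul_sum_inter p (fun _ => 1) S
  simp only [one_mul, sum_const, nsmul_eq_mul, mul_one] at hcard
  rw [← min_add_add_left, le_min_iff]
  constructor
  · rw [add_zero, ← hv]
    refine sum_le_sum fun A _ => mul_le_mul_of_nonneg_left ?_ (bernWeight_nonneg hp A)
    exact sub_le_self _ (le_max_right _ _)
  · calc simReward k p v S
        ≤ ∑ A : Finset (Fin n), bernWeight p A *
            ((∑ i ∈ S ∩ A, v i) - (((S ∩ A).card : ℝ) - (k : ℝ))) :=
          sum_le_sum fun A _ => mul_le_mul_of_nonneg_left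
            (sub_le_sub_left (le_max_left _ _) _) (bernWeight_nonneg hp A)
      _ = ∑ i ∈ S, v i * p i + ((k : ℝ) - ∑ i ∈ S, p i) := by
          simp only [mul_sub, sum_sub_distrib, ← sum_mul, hv, hcard, sum_bernWeight]
          ring

/-- **LP upper bound for simultaneous offering (Lemma: sim_LP_ub).**
For every offer set `S`, the simultaneous-offering reward is at most the value of `LP_sim`. -/
theorem stmt6 (n k : ℕ) (hn : 0 < n) (hk : 0 < k)
    (p v : Fin n → ℝ) (hp : ∀ i, p i ∈ Set.Icc (0:ℝ) 1) (hv : ∀ i, 0 ≤ v i)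
    (S : Finset (Fin n)) :
    simReward k p v S ≤
      sSup {z : ℝ | ∃ y : Fin n → ℝ, (∀ i, y i ∈ Set.Icc (0:ℝ) 1) ∧
        z = ∑ i, v i * p i * y i + min 0 ((k:ℝ) - ∑ i, p i * y i)} := by
  have hbdd : BddAbove {z : ℝ | ∃ y : Fin n → ℝ, (∀ i, y i ∈ Set.Icc (0:ℝ) 1) ∧
      z = ∑ i, v i * p i * y i + min 0 ((k:ℝ) - ∑ i, p i * y i)} := by
    refine ⟨∑ i, v i * p i, ?_⟩
    rintro z ⟨y, hy, rfl⟩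
    have hsum : ∑ i, v i * p i * y i ≤ ∑ i, v i * p i :=
      sum_le_sum fun i _ => mul_le_of_le_one_right (mul_nonneg (hv i) (hp i).1) (hy i).2
    linarith [min_le_left 0 ((k:ℝ) - ∑ i, p i * y i)]
  refine (simReward_le k hp v S).trans
    (le_csSup hbdd ⟨fun i => if i ∈ S then 1 else 0, fun i => ?_, ?_⟩)
  · dsimp only
    split_ifs <;> simp
  · simp
end

section
/- Fix a positive integer k, a positive integer n, probabilities p_1,…,p_n ∈ [0,1] and values v_1 ≥ v_2 ≥ ⋯ ≥ v_n ≥ 0. Define LP_sim as the supremum over y ∈ [0,1]^n of Σ_{i=1}^n v_i p_i y_i + min(0, k − Σ_{i=1}^n p_i y_i). Then there exists y ∈ [0,1]^n attaining LP_sim (i.e., the supremum is a maximum attained at y) together with an index j ∈ {1,…,n} such that y_i = 1 for all 1 ≤ i ≤ j−1, y_j > 0, and y_i = 0 for all j+1 ≤ i ≤ n. -/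
open Finset

/-- The value of the simultaneous-offering LP relaxation `LP_sim`. -/
noncomputable def lpSim (n k : ℕ) (p v : Fin n → ℝ) : ℝ :=
  sSup {z : ℝ | ∃ y : Fin n → ℝ, (∀ i, y i ∈ Set.Icc (0:ℝ) 1) ∧
    z = ∑ i, v i * p i * y i + min 0 ((k:ℝ) - ∑ i, p i * y i)}

/-- Complementary slackness: a feasible `y` with a multiplier `l ∈ [0,1]` for the capacity
constraint satisfying the optimality conditions attains `lpSim`. -/
theorem eq_lpSim_of_multiplier {n k : ℕ} {p v y : Fin n → ℝ} {l : ℝ}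
    (hp : ∀ i, 0 ≤ p i) (hy : ∀ i, y i ∈ Set.Icc (0:ℝ) 1) (hl : l ∈ Set.Icc (0:ℝ) 1)
    (hone : ∀ i, l < v i → y i = 1) (hzero : ∀ i, v i < l → y i = 0)
    (hslack : l * ((k:ℝ) - ∑ i, p i * y i) = min 0 ((k:ℝ) - ∑ i, p i * y i)) :
    ∑ i, v i * p i * y i + min 0 ((k:ℝ) - ∑ i, p i * y i) = lpSim n k p v := by
  symm
  rw [lpSim]
  refine IsGreatest.csSup_eq ⟨⟨y, hy, rfl⟩, ?_⟩
  rintro _ ⟨x, hx, rfl⟩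
  have lagrangian : ∀ w : Fin n → ℝ, ∑ i, v i * p i * w i + l * ((k:ℝ) - ∑ i, p i * w i)
      = l * k + ∑ i, (v i - l) * p i * w i := fun w => by
    simp only [sub_mul, Finset.sum_sub_distrib, mul_sub, Finset.mul_sum, mul_assoc]
    ring
  have hmin : ∀ s : ℝ, min 0 s ≤ l * s := fun s => by
    rcases le_total 0 s with h | h
    · rw [min_eq_left h]
      exact mul_nonneg hl.1 h
    · rw [min_eq_right h]
      nlinarith [hl.2]
  have hterm : ∑ i, (v i - l) * p i * x i ≤ ∑ i, (v i - l) * p i * y i := by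
    refine Finset.sum_le_sum fun i _ => ?_
    rcases lt_trichotomy l (v i) with h | h | h
    · rw [hone i h]
      exact mul_le_mul_of_nonneg_left (hx i).2 (mul_nonneg (sub_nonneg.2 h.le) (hp i))
    · simp [h]
    · rw [hzero i h, mul_zero]
      exact mul_nonpos_of_nonpos_of_nonneg
        (mul_nonpos_of_nonpos_of_nonneg (sub_nonpos.2 h.le) (hp i)) (hx i).1
  calc _ ≤ ∑ i, v i * p i * x i + l * ((k:ℝ) - ∑ i, p i * x i) := by gcongr; exact hmin _
    _ ≤ ∑ i, v i * p i * y i + l * ((k:ℝ) - ∑ i, p i * y i) := by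
      rw [lagrangian, lagrangian]; gcongr
    _ = _ := by rw [hslack]

/-- The first index at which the partial sums of `p` reach a positive level `c`. -/
theorem exists_sum_Iio_lt_le_sum_Iic {n : ℕ} {p : Fin n → ℝ} {c : ℝ} (hc : 0 < c)
    (h : c ≤ ∑ i, p i) : ∃ m : Fin n, ∑ i ∈ Iio m, p i < c ∧ c ≤ ∑ i ∈ Iic m, p i := by
  have hne : (univ.filter fun m : Fin n => c ≤ ∑ i ∈ Iic m, p i).Nonempty := by
    obtain _ | n := n
    · simp at h
      linarith
    · refine ⟨Fin.last n, ?_⟩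
      have : (Iic (Fin.last n)) = univ := by ext i; simp [Fin.le_last]
      simpa [this] using h
  refine ⟨_, ?_, (mem_filter.1 (min'_mem _ hne)).2⟩
  set m := min' _ hne
  rcases (Iio m).eq_empty_or_nonempty with he | he
  · simpa [he] using hc
  · have hlt : (Iio m).max' he < m := mem_Iio.1 (max'_mem _ he)
    have heq : Iio m = Iic ((Iio m).max' he) := by
      ext i
      rw [mem_Iic]
      exact ⟨fun hi => le_max' _ _ hi, fun hi => mem_Iio.2 (hi.trans_lt hlt)⟩
    rw [heq]
    by_contra! hge
    exact (min'_le _ ((Iio m).max' he) (mem_filter.2 ⟨mem_univ _, hge⟩)).not_gt hlt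

/-- **Threshold structure of optimal LP_sim solutions (Lemma: simDecreasingSol).**
With values sorted decreasingly, `LP_sim` is attained at some `y ∈ [0,1]^n` having an index
`j` with `y i = 1` for `i < j`, `y j > 0`, and `y i = 0` for `i > j`. -/
theorem stmt7 (n k : ℕ) (hn : 0 < n) (hk : 0 < k)
    (p v : Fin n → ℝ) (hp : ∀ i, p i ∈ Set.Icc (0:ℝ) 1)
    (hvmono : ∀ i j : Fin n, i ≤ j → v j ≤ v i) (hv : ∀ i, 0 ≤ v i) :
    ∃ y : Fin n → ℝ, ∃ j : Fin n,
      (∀ i, y i ∈ Set.Icc (0:ℝ) 1) ∧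
      (∑ i, v i * p i * y i + min 0 ((k:ℝ) - ∑ i, p i * y i) = lpSim n k p v) ∧
      (∀ i, i < j → y i = 1) ∧ 0 < y j ∧ (∀ i, j < i → y i = 0) := by
  have hp0 : ∀ i, 0 ≤ p i := fun i => (hp i).1
  have hk' : (0:ℝ) < k := by exact_mod_cast hk
  by_cases hA : (k:ℝ) ≤ ∑ i with 1 ≤ v i, p i
  · have hne : (univ.filter fun i => 1 ≤ v i).Nonempty := by
      by_contra! he
      rw [he, sum_empty] at hA
      linarith
    have hmem := (mem_filter.1 (max'_mem _ hne)).2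
    have hy : ∀ i, (if 1 ≤ v i then 1 else 0) ∈ Set.Icc (0:ℝ) 1 := by
      intro i
      split_ifs <;> simp
    refine ⟨fun i => if 1 ≤ v i then 1 else 0, max' _ hne, hy, ?_, ?_, ?_, ?_⟩
    · refine eq_lpSim_of_multiplier (l := 1) hp0 hy (by simp) ?_ ?_ ?_
      · exact fun i hi => if_pos hi.le
      · exact fun i hi => if_neg hi.not_ge
      · simp only [mul_ite, mul_one, mul_zero, ← sum_filter, one_mul]
        rw [min_eq_right (by linarith)]
    · exact fun i hi => if_pos (hmem.trans (hvmono _ _ hi.le))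
    · simp [hmem]
    · intro i hi
      refine if_neg fun h => ?_
      exact (le_max' _ i (mem_filter.2 ⟨mem_univ _, h⟩)).not_gt hi
  · by_cases hT : ∑ i, p i ≤ k
    · refine ⟨fun _ => 1, ⟨n - 1, by omega⟩, by simp, ?_, fun _ _ => rfl, one_pos, ?_⟩
      · refine eq_lpSim_of_multiplier (l := 0) hp0 (by simp) (by simp) (fun _ _ => rfl) ?_ ?_
        · exact fun i hi => absurd (hv i) hi.not_ge
        · simp [hT]
      · intro i hi
        have := Fin.lt_def.1 hi
        have := i.2
        simp only at *
        omega
    · obtain ⟨m, hlt, hle⟩ := exists_sum_Iio_lt_le_sum_Iic hk' (le_of_not_ge hT)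
      have hsum : ∑ i ∈ Iic m, p i = p m + ∑ i ∈ Iio m, p i := by
        rw [← Iio_insert, sum_insert (by simp)]
      have hpm : 0 < p m := by linarith
      have hvm : v m < 1 := by
        by_contra! h
        refine hA (hle.trans (sum_le_sum_of_subset_of_nonneg ?_ fun i _ _ => hp0 i))
        exact fun i hi => mem_filter.2 ⟨mem_univ _, h.trans (hvmono _ _ (mem_Iic.1 hi))⟩
      set c := (k - ∑ i ∈ Iio m, p i) / p m with hc
      have hc0 : 0 < c := div_pos (by linarith) hpm
      have hc1 : c ≤ 1 := (div_le_one hpm).2 (by linarith)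
      have hy : ∀ i, (if i < m then 1 else if i = m then c else 0) ∈ Set.Icc (0:ℝ) 1 := by
        intro i
        split_ifs
        · simp
        · exact ⟨hc0.le, hc1⟩
        · simp
      have hcap : ∑ i, p i * (if i < m then 1 else if i = m then c else 0) = k := by
        have hsplit : ∀ i, p i * (if i < m then 1 else if i = m then c else 0)
            = (if i < m then p i else 0) + (if i = m then p i * c else 0) := by
          intro i
          rcases lt_trichotomy i m with h | h | h
          · simp [h, h.ne]
          · simp [h]
          · simp [h.not_gt, h.ne']
        have hfilter : (univ.filter fun i => i < m) = Iio m := by ext; simp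
        rw [sum_congr rfl fun i _ => hsplit i, sum_add_distrib, ← sum_filter, hfilter,
          sum_ite_eq' univ m, if_pos (mem_univ m), hc]
        field_simp
        ring
      refine ⟨fun i => if i < m then 1 else if i = m then c else 0, m, hy, ?_,
        fun i hi => if_pos hi, by simpa using hc0, fun i hi => by simp [hi.not_gt, hi.ne']⟩
      refine eq_lpSim_of_multiplier (l := v m) hp0 hy ⟨hv m, hvm.le⟩ ?_ ?_ ?_
      · exact fun i hi => if_pos (lt_of_not_ge fun h => (hvmono _ _ h).not_gt hi)
      · intro i hi
        have : m < i := lt_of_not_ge fun h => (hvmono _ _ h).not_gt hi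
        simp [this.not_gt, this.ne']
      · rw [hcap]
        simp
end

section
/- Fix an integer k ≥ 1, τ ∈ (0,1), s ∈ [0,1], an integer n ≥ 1, probabilities p_1,…,p_n ∈ [0,1] and values v_1 ≥ v_2 ≥ ⋯ ≥ v_n ≥ τ satisfying Σ_{i : v_i > 1} p_i ≤ k. Define LP_sim as the supremum over y ∈ [0,1]^n of Σ_{i=1}^n v_i p_i y_i + min(0, k − Σ_{i=1}^n p_i y_i), and let y ∈ [0,1]^n attain LP_sim with threshold structure (there is an index j₀ with y_i = 1 for i < j₀, y_{j₀} > 0, y_i = 0 for i > j₀). Set κ = s · Σ_{i=1}^n y_i p_i, and let y′ ∈ [0,1]^n be a threshold vector obtained by filling mass from smallest index: y′_i = 1 for i ≤ j, y′_{j+1} ∈ [0,1) chosen so that Σ_{i=1}^n y′_i p_i = κ, and y′_i = 0 for i > j+1, where j is the largest index with Σ_{i=1}^j p_i ≤ κ. Let D′_1,…,D′_n be independent Bernoulli random variables with P(D′_i = 1) = y′_i p_i. Then Σ_{i=1}^n v_i y′_i p_i − E[max(Σ_{i=1}^n D′_i − k, 0)] ≥ (s − s/τ + E[min(Pois(sk),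 k)]/(τk)) · LP_sim, where for λ ≥ 0, E[min(Pois(λ), k)] denotes Σ_{j=0}^∞ min(j, k) e^{−λ} λ^j / j!. -/
open Finset

/-- `E[min(Pois(λ), k)] = ∑_{j=0}^∞ min(j,k) e^{−λ} λ^j / j!`. -/
noncomputable def poisMin (k : ℕ) (lam : ℝ) : ℝ :=
  ∑' j : ℕ, min (j : ℝ) (k : ℝ) * (Real.exp (-lam) * lam ^ j / (Nat.factorial j : ℝ))

/-- The Poisson point mass `e^{-x} x^j / j!`. -/
noncomputable def poisMass (j : ℕ) (x : ℝ) : ℝ :=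
  Real.exp (-x) * x ^ j / (Nat.factorial j : ℝ)

/-- The probability that a Poisson variable of mean `x` is smaller than `k`. -/
noncomputable def poisBelow (k : ℕ) (x : ℝ) : ℝ := ∑ j ∈ range k, poisMass j x

/-- The expected shortfall `E[max(k - Pois(x), 0)]`. -/
noncomputable def poisShortfall (k : ℕ) (x : ℝ) : ℝ :=
  ∑ j ∈ range k, ((k : ℝ) - j) * poisMass j x

lemma poisMass_nonneg (j : ℕ) {x : ℝ} (hx : 0 ≤ x) : 0 ≤ poisMass j x := by
  unfold poisMass; positivity

lemma hasSum_poisMass (x : ℝ) : HasSum (fun j => poisMass j x) 1 := by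
  have h := (NormedSpace.expSeries_div_hasSum_exp x).mul_left (Real.exp (-x))
  rw [← Real.exp_eq_exp_ℝ, ← Real.exp_add, neg_add_cancel, Real.exp_zero] at h
  simpa only [poisMass, mul_div_assoc] using h

lemma poisBelow_nonneg (k : ℕ) {x : ℝ} (hx : 0 ≤ x) : 0 ≤ poisBelow k x :=
  sum_nonneg fun j _ => poisMass_nonneg j hx

lemma poisBelow_le_one (k : ℕ) {x : ℝ} (hx : 0 ≤ x) : poisBelow k x ≤ 1 :=
  sum_le_hasSum _ (fun j _ => poisMass_nonneg j hx) (hasSum_poisMass x)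

lemma poisShortfall_succ (k : ℕ) (x : ℝ) :
    poisShortfall (k + 1) x = poisShortfall k x + poisBelow (k + 1) x := by
  simp only [poisShortfall, poisBelow, sum_range_succ, ← add_assoc, ← sum_add_distrib]
  congr 1
  · exact sum_congr rfl fun j _ => by push_cast; ring
  · push_cast; ring

lemma poisShortfall_zero_right (k : ℕ) : poisShortfall k 0 = k := by
  cases k with
  | zero => simp [poisShortfall]
  | succ k => simp [poisShortfall, poisMass, sum_range_succ']

lemma poisMin_eq (k : ℕ) (x : ℝ) : poisMin k x = k - poisShortfall k x := by
  have h1 := (hasSum_poisMass x).mul_left (k : ℝ)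
  have h2 : HasSum (fun j : ℕ => ((k - j : ℕ) : ℝ) * poisMass j x) (poisShortfall k x) := by
    have h3 : poisShortfall k x = ∑ j ∈ range k, ((k - j : ℕ) : ℝ) * poisMass j x :=
      sum_congr rfl fun j hj => by rw [Nat.cast_sub (mem_range.1 hj).le]
    rw [h3]
    refine hasSum_sum_of_ne_finset_zero fun j hj => ?_
    rw [Nat.sub_eq_zero_of_le (by simpa using hj)]
    simp
  have h3 := h1.sub h2
  rw [mul_one] at h3
  rw [← h3.tsum_eq, poisMin]
  refine tsum_congr fun j => ?_
  rw [← sub_mul, poisMass]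
  congr 1
  rcases le_total j k with h | h
  · rw [Nat.cast_sub h, min_eq_left (by exact_mod_cast h)]; ring
  · rw [Nat.sub_eq_zero_of_le h, min_eq_right (by exact_mod_cast h)]; simp

lemma hasDerivAt_poisMass_succ (j : ℕ) (x : ℝ) :
    HasDerivAt (poisMass (j + 1)) (poisMass j x - poisMass (j + 1) x) x := by
  have h := (((hasDerivAt_neg x).exp).mul (hasDerivAt_pow (j + 1) x)).div_const
    (Nat.factorial (j + 1) : ℝ)
  refine h.congr_deriv ?_
  have : (Nat.factorial j : ℝ) ≠ 0 := by positivity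
  simp only [poisMass, Nat.factorial_succ]
  push_cast
  field_simp
  ring

lemma hasDerivAt_poisBelow_succ (k : ℕ) (x : ℝ) :
    HasDerivAt (poisBelow (k + 1)) (-poisMass k x) x := by
  induction k with
  | zero =>
    have h := (hasDerivAt_neg x).exp
    have h0 : poisBelow (0 + 1) = fun x => Real.exp (-x) := by
      ext x; simp [poisBelow, poisMass]
    rw [h0]
    exact h.congr_deriv (by simp [poisMass])
  | succ k ih =>
    have h0 : poisBelow (k + 1 + 1) = fun x => poisBelow (k + 1) x + poisMass (k + 1) x := by
      ext x; simp [poisBelow, sum_range_succ]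
    rw [h0]
    exact (ih.add (hasDerivAt_poisMass_succ k x)).congr_deriv (by ring)

lemma hasDerivAt_poisShortfall (k : ℕ) (x : ℝ) :
    HasDerivAt (poisShortfall k) (-poisBelow k x) x := by
  induction k with
  | zero =>
    have h0 : poisShortfall 0 = fun _ => 0 := by ext x; simp [poisShortfall]
    rw [h0]
    exact (hasDerivAt_const x (0 : ℝ)).congr_deriv (by simp [poisBelow])
  | succ k ih =>
    have h0 : poisShortfall (k + 1) = fun x => poisShortfall k x + poisBelow (k + 1) x :=
      funext fun x => poisShortfall_succ k x
    rw [h0]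
    exact (ih.add (hasDerivAt_poisBelow_succ k x)).congr_deriv
      (by simp only [poisBelow, sum_range_succ]; ring)

lemma antitoneOn_poisBelow (k : ℕ) : AntitoneOn (poisBelow k) (Set.Ici 0) := by
  cases k with
  | zero => intro a _ b _ _; simp [poisBelow]
  | succ k =>
    refine antitoneOn_of_deriv_nonpos (convex_Ici 0)
      (fun x _ => (hasDerivAt_poisBelow_succ k x).continuousAt.continuousWithinAt)
      (fun x _ => (hasDerivAt_poisBelow_succ k x).differentiableAt.differentiableWithinAt)
      fun x hx => ?_
    rw [interior_Ici, Set.mem_Ioi] at hx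
    rw [(hasDerivAt_poisBelow_succ k x).deriv]
    exact neg_nonpos.2 (poisMass_nonneg k hx.le)

/-- The graph of the convex function `poisShortfall k` lies above its tangents. -/
lemma poisShortfall_tangent_le (k : ℕ) {a b : ℝ} (ha : 0 ≤ a) (hb : 0 ≤ b) :
    poisShortfall k a - (b - a) * poisBelow k a ≤ poisShortfall k b := by
  have hc : ∀ s : Set ℝ, ContinuousOn (poisShortfall k) s := fun s x _ =>
    (hasDerivAt_poisShortfall k x).continuousAt.continuousWithinAt
  rcases lt_trichotomy a b with h | rfl | h
  · obtain ⟨c, hc, he⟩ := exists_hasDerivAt_eq_slope (poisShortfall k) _ h (hc _)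
      fun x _ => hasDerivAt_poisShortfall k x
    have hG := antitoneOn_poisBelow k ha (ha.trans hc.1.le) hc.1.le
    rw [eq_div_iff (sub_pos.2 h).ne'] at he
    nlinarith
  · simp
  · obtain ⟨c, hc, he⟩ := exists_hasDerivAt_eq_slope (poisShortfall k) _ h (hc _)
      fun x _ => hasDerivAt_poisShortfall k x
    have hG := antitoneOn_poisBelow k (hb.trans hc.1.le) ha hc.2.le
    rw [eq_div_iff (sub_pos.2 h).ne'] at he
    nlinarith

lemma poisMin_mono (k : ℕ) {a b : ℝ} (ha : 0 ≤ a) (hab : a ≤ b) : poisMin k a ≤ poisMin k b := by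
  have hb := ha.trans hab
  have h := poisShortfall_tangent_le k hb ha
  have := mul_nonneg (sub_nonneg.2 hab) (poisBelow_nonneg k hb)
  rw [poisMin_eq, poisMin_eq]
  linarith

lemma poisMin_le_self (k : ℕ) {a : ℝ} (ha : 0 ≤ a) : poisMin k a ≤ a := by
  have h := poisShortfall_tangent_le k le_rfl ha
  have := mul_le_mul_of_nonneg_left (poisBelow_le_one k (le_refl (0 : ℝ))) ha
  rw [poisShortfall_zero_right] at h
  rw [poisMin_eq]
  linarith

lemma mul_poisMin_le (k : ℕ) {t a : ℝ} (ht : 0 ≤ t) (ht1 : t ≤ 1) (ha : 0 ≤ a) :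
    t * poisMin k a ≤ poisMin k (t * a) := by
  have hx := mul_nonneg ht ha
  have h0 := poisShortfall_tangent_le k hx le_rfl
  have h1 := poisShortfall_tangent_le k hx ha
  rw [poisShortfall_zero_right] at h0
  rw [poisMin_eq, poisMin_eq]
  linear_combination (1 - t) * h0 + t * h1

section Bernoulli

variable {ι : Type*} [DecidableEq ι]

/-- The expectation of `g` at the number of successes among independent trials indexed by `S`
with success probabilities `q`. -/
noncomputable def bernExp (q : ι → ℝ) (S : Finset ι) (g : ℕ → ℝ) : ℝ :=
  ∑ A ∈ S.powerset, ((∏ i ∈ A, q i) * ∏ i ∈ S \ A, (1 - q i)) * g A.card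

lemma bernExp_empty (q : ι → ℝ) (g : ℕ → ℝ) : bernExp q ∅ g = g 0 := by
  simp [bernExp]

lemma bernExp_insert (q : ι → ℝ) {S : Finset ι} {a : ι} (ha : a ∉ S) (g : ℕ → ℝ) :
    bernExp q (insert a S) g
      = (1 - q a) * bernExp q S g + q a * bernExp q S fun j => g (j + 1) := by
  unfold bernExp
  rw [sum_powerset_insert ha, mul_sum, mul_sum]
  congr 1
  · refine sum_congr rfl fun A hA => ?_
    have haA : a ∉ A := fun h => ha (mem_powerset.1 hA h)
    rw [insert_sdiff_of_notMem _ haA, prod_insert (by simp [ha])]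
    ring
  · refine sum_congr rfl fun A hA => ?_
    have haA : a ∉ A := fun h => ha (mem_powerset.1 hA h)
    rw [insert_sdiff_insert, sdiff_insert_of_notMem ha, prod_insert haA, card_insert_of_notMem haA]
    ring

lemma bernExp_add (q : ι → ℝ) (S : Finset ι) (g h : ℕ → ℝ) :
    bernExp q S (fun j => g j + h j) = bernExp q S g + bernExp q S h := by
  simp only [bernExp, mul_add, sum_add_distrib]

lemma bernExp_const (q : ι → ℝ) (S : Finset ι) (c : ℝ) : bernExp q S (fun _ => c) = c := by
  induction S using Finset.induction_on with
  | empty => rw [bernExp_empty]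
  | insert a S ha ih => rw [bernExp_insert q ha, ih]; ring

lemma bernExp_natCast (q : ι → ℝ) (S : Finset ι) :
    bernExp q S (fun j => (j : ℝ)) = ∑ i ∈ S, q i := by
  induction S using Finset.induction_on with
  | empty => simp [bernExp_empty]
  | insert a S ha ih =>
    simp only [bernExp_insert q ha, Nat.cast_add, Nat.cast_one, bernExp_add, bernExp_const, ih,
      sum_insert ha]
    ring

/-- The expected shortfall of a sum of independent Bernoulli variables is at most that of the
Poisson variable with the same mean. -/
lemma bernExp_shortfall_le (q : ι → ℝ) (S : Finset ι) (hq : ∀ i ∈ S, q i ∈ Set.Icc (0 : ℝ) 1)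
    (k : ℕ) : bernExp q S (fun j => ((k - j : ℕ) : ℝ)) ≤ poisShortfall k (∑ i ∈ S, q i) := by
  induction S using Finset.induction_on generalizing k with
  | empty => simp [bernExp_empty, poisShortfall_zero_right]
  | insert a S ha ih =>
    have ih := ih fun i hi => hq i (mem_insert_of_mem hi)
    obtain ⟨h0, h1⟩ := hq a (mem_insert_self a S)
    cases k with
    | zero => simp [bernExp_const, poisShortfall]
    | succ k =>
      have hS : 0 ≤ ∑ i ∈ S, q i := sum_nonneg fun i hi => (hq i (mem_insert_of_mem hi)).1
      have ht := poisShortfall_tangent_le (k + 1) hS (add_nonneg h0 hS)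
      have hs := poisShortfall_succ k (∑ i ∈ S, q i)
      simp only [bernExp_insert q ha, Nat.add_sub_add_right, sum_insert ha]
      linear_combination (1 - q a) * ih (k + 1) + q a * ih k + ht - q a * hs

end Bernoulli

lemma sum_bernWeight_excess_le {n : ℕ} (q : Fin n → ℝ) (hq : ∀ i, q i ∈ Set.Icc (0 : ℝ) 1)
    (k : ℕ) : ∑ A : Finset (Fin n), bernWeight q A * max ((A.card : ℝ) - (k : ℝ)) 0
      ≤ ∑ i, q i - poisMin k (∑ i, q i) := by
  have h1 : ∑ A : Finset (Fin n), bernWeight q A * max ((A.card : ℝ) - (k : ℝ)) 0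
      = bernExp q univ fun j => ((j : ℝ) + -(k : ℝ)) + ((k - j : ℕ) : ℝ) := by
    rw [bernExp, powerset_univ]
    refine sum_congr rfl fun A _ => ?_
    rw [bernWeight, compl_eq_univ_sdiff]
    congr 1
    rcases le_total A.card k with h | h
    · have h' : (A.card : ℝ) ≤ k := by exact_mod_cast h
      rw [max_eq_right (by linarith), Nat.cast_sub h]; ring
    · have h' : (k : ℝ) ≤ A.card := by exact_mod_cast h
      rw [max_eq_left (by linarith), Nat.sub_eq_zero_of_le h]; simp [sub_eq_add_neg]
  rw [h1, bernExp_add, bernExp_add, bernExp_natCast, bernExp_const, poisMin_eq]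
  linarith [bernExp_shortfall_le q univ (fun i _ => hq i) k]

/-- Moving mass to the indices of larger value does not decrease the total value. -/
lemma sum_mul_le_sum_mul_of_prefix {n : ℕ} {p v z y' : Fin n → ℝ} (hp : ∀ i, 0 ≤ p i)
    (hv : ∀ i, 0 ≤ v i) (hvmono : ∀ i j : Fin n, i ≤ j → v j ≤ v i)
    (hz : ∀ i, z i ∈ Set.Icc (0 : ℝ) 1) (hmass : ∑ i, y' i * p i = ∑ i, z i * p i) {j : ℕ}
    (hlt : ∀ i : Fin n, (i : ℕ) < j → y' i = 1) (hgt : ∀ i : Fin n, j < (i : ℕ) → y' i = 0) :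
    ∑ i, v i * (z i * p i) ≤ ∑ i, v i * (y' i * p i) := by
  by_cases hj : j < n
  · set c := v ⟨j, hj⟩
    have h : ∀ i, (v i - c) * (z i * p i) ≤ (v i - c) * (y' i * p i) := by
      intro i
      rcases lt_trichotomy (i : ℕ) j with h | h | h
      · have h1 : c ≤ v i := hvmono i ⟨j, hj⟩ h.le
        rw [hlt i h]
        exact mul_le_mul_of_nonneg_left (mul_le_mul_of_nonneg_right (hz i).2 (hp i))
          (sub_nonneg.2 h1)
      · obtain rfl : i = ⟨j, hj⟩ := Fin.ext h
        simp [c]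
      · have h1 : v i ≤ c := hvmono ⟨j, hj⟩ i h.le
        rw [hgt i h]
        exact mul_le_mul_of_nonpos_left (mul_le_mul_of_nonneg_right (hz i).1 (hp i))
          (sub_nonpos.2 h1)
    have hs := sum_le_sum fun i (_ : i ∈ univ) => h i
    simp only [sub_mul, sum_sub_distrib, ← mul_sum, hmass] at hs
    linarith
  · refine sum_le_sum fun i _ => ?_
    rw [hlt i (by omega)]
    exact mul_le_mul_of_nonneg_left (mul_le_mul_of_nonneg_right (hz i).2 (hp i)) (hv i)

lemma le_lpSim {n k : ℕ} {p v z : Fin n → ℝ} (hp : ∀ i, 0 ≤ p i) (hv : ∀ i, 0 ≤ v i)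
    (hz : ∀ i, z i ∈ Set.Icc (0 : ℝ) 1) :
    ∑ i, v i * p i * z i + min 0 ((k : ℝ) - ∑ i, p i * z i) ≤ lpSim n k p v := by
  refine le_csSup ⟨∑ i, v i * p i, ?_⟩ ⟨z, hz, rfl⟩
  rintro _ ⟨w, hw, rfl⟩
  have h1 : ∑ i, v i * p i * w i ≤ ∑ i, v i * p i :=
    sum_le_sum fun i _ => mul_le_of_le_one_right (mul_nonneg (hv i) (hp i)) (hw i).2
  linarith [min_le_left 0 ((k : ℝ) - ∑ i, p i * w i)]

/-- **Guarantee of the truncated value-ordered policy `ALG_sim^s` (Lemma: simul_fixed_s).**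
On a `τ`-bounded instance with `∑_{i : v i > 1} p i ≤ k`, the `s`-truncation `y'` of an
optimal threshold LP solution `y` (a threshold vector of total mass `κ = s ∑ y i p i`)
satisfies `∑ v i y' i p i − E[max(∑ D'_i − k, 0)] ≥ (s − s/τ + E[min(Pois(sk),k)]/(τk)) · LP_sim`,
where `D'_i` are independent Bernoulli with means `y' i * p i`. -/
theorem stmt9 (n k : ℕ) (hn : 0 < n) (hk : 0 < k)
    (τ s : ℝ) (hτ : τ ∈ Set.Ioo (0:ℝ) 1) (hs : s ∈ Set.Icc (0:ℝ) 1)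
    (p v : Fin n → ℝ) (hp : ∀ i, p i ∈ Set.Icc (0:ℝ) 1)
    (hvmono : ∀ i j : Fin n, i ≤ j → v j ≤ v i) (hvτ : ∀ i, τ ≤ v i)
    (hhigh : ∑ i ∈ univ.filter (fun i => 1 < v i), p i ≤ (k:ℝ))
    (y : Fin n → ℝ) (hyfeas : ∀ i, y i ∈ Set.Icc (0:ℝ) 1)
    (hyopt : ∑ i, v i * p i * y i + min 0 ((k:ℝ) - ∑ i, p i * y i) = lpSim n k p v)
    (hythresh : ∃ j₀ : Fin n, (∀ i, i < j₀ → y i = 1) ∧ 0 < y j₀ ∧ ∀ i, j₀ < i → y i = 0)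
    (y' : Fin n → ℝ)
    (hy'mass : ∑ i, y' i * p i = s * ∑ i, y i * p i)
    (hy'thresh : ∃ j : ℕ,
      (∑ i ∈ univ.filter (fun i : Fin n => (i:ℕ) < j), p i ≤ s * ∑ i, y i * p i) ∧
      (∀ i : Fin n, (i:ℕ) < j → y' i = 1) ∧
      (∀ i : Fin n, (i:ℕ) = j → 0 ≤ y' i ∧ y' i < 1) ∧
      (∀ i : Fin n, j < (i:ℕ) → y' i = 0)) :
    (∑ i, v i * (y' i * p i))
      - (∑ A : Finset (Fin n), bernWeight (fun i => y' i * p i) A * max ((A.card : ℝ) - (k:ℝ)) 0)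
    ≥ (s - s/τ + poisMin k (s*k) / (τ*k)) * lpSim n k p v := by
  obtain ⟨hτ0, hτ1⟩ := hτ
  obtain ⟨hs0, hs1⟩ := hs
  have hp0 : ∀ i, 0 ≤ p i := fun i => (hp i).1
  have hv0 : ∀ i, 0 ≤ v i := fun i => hτ0.le.trans (hvτ i)
  have hk0 : (0 : ℝ) < k := by exact_mod_cast hk
  obtain ⟨j, -, hlt, heq, hgt⟩ := hy'thresh
  have hy'01 : ∀ i, y' i ∈ Set.Icc (0 : ℝ) 1 := by
    intro i
    rcases lt_trichotomy (i : ℕ) j with h | h | h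
    · simp [hlt i h]
    · exact ⟨(heq i h).1, (heq i h).2.le⟩
    · simp [hgt i h]
  have hexcess := sum_bernWeight_excess_le (fun i => y' i * p i)
    (fun i => ⟨mul_nonneg (hy'01 i).1 (hp0 i), mul_le_one₀ (hy'01 i).2 (hp0 i) (hp i).2⟩) k
  have hvalue := sum_mul_le_sum_mul_of_prefix (z := fun i => s * y i) hp0 hv0 hvmono
    (fun i => ⟨mul_nonneg hs0 (hyfeas i).1, mul_le_one₀ hs1 (hyfeas i).1 (hyfeas i).2⟩)
    (by rw [hy'mass, mul_sum]; exact sum_congr rfl fun i _ => by ring) hlt hgt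
  have hscale : ∑ i, v i * (s * y i * p i) = s * ∑ i, v i * p i * y i := by
    rw [mul_sum]; exact sum_congr rfl fun i _ => by ring
  have hcomm : ∑ i, p i * y i = ∑ i, y i * p i := sum_congr rfl fun i _ => mul_comm _ _
  have hlp : ∀ c : ℝ, 0 ≤ c → c ≤ 1 →
      c * (∑ i, v i * p i * y i) + min 0 ((k : ℝ) - c * ∑ i, p i * y i) ≤ lpSim n k p v := by
    intro c hc0 hc1
    have h := le_lpSim (k := k) (z := fun i => c * y i) hp0 hv0
      (fun i => ⟨mul_nonneg hc0 (hyfeas i).1, mul_le_one₀ hc1 (hyfeas i).1 (hyfeas i).2⟩)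
    simpa only [mul_sum, mul_left_comm c] using h
  have hV : τ * ∑ i, y i * p i ≤ ∑ i, v i * p i * y i := by
    rw [mul_sum]
    refine sum_le_sum fun i _ => ?_
    have := mul_le_mul_of_nonneg_right (hvτ i) (mul_nonneg (hyfeas i).1 (hp0 i))
    linarith
  have hM0 : 0 ≤ ∑ i, y i * p i := sum_nonneg fun i _ => mul_nonneg (hyfeas i).1 (hp0 i)
  rw [hy'mass] at hexcess
  rw [hscale] at hvalue
  rw [hcomm] at hyopt hlp
  set M := ∑ i, y i * p i
  set V := ∑ i, v i * p i * y i
  set L := lpSim n k p v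
  have ha : poisMin k (s * k) ≤ s * k := poisMin_le_self k (by positivity)
  set a := poisMin k (s * k) / k with ha_def
  have hak : poisMin k (s * k) = a * k := by rw [ha_def]; field_simp
  have has : a ≤ s := by rw [ha_def, div_le_iff₀ hk0]; exact ha
  have hcoef : s - s / τ + poisMin k (s * k) / (τ * k) = s - (s - a) / τ := by
    rw [ha_def]; field_simp; ring
  rw [hcoef, ge_iff_le]
  suffices h : (s - (s - a) / τ) * L ≤ s * V - s * M + poisMin k (s * M) by linarith
  rcases le_or_gt M k with hMk | hMk
  · have hL : L = V := by rw [← hyopt, min_eq_left (by linarith), add_zero]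
    have hP := mul_poisMin_le k (div_nonneg hM0 hk0.le) ((div_le_one hk0).2 hMk)
      (mul_nonneg hs0 hk0.le)
    rw [hak, show M / k * (s * k) = s * M by field_simp,
      show M / k * (a * k) = a * M by field_simp] at hP
    have hMV : M ≤ V / τ := by rw [le_div_iff₀ hτ0]; linarith
    have h1 := mul_le_mul_of_nonneg_left hMV (sub_nonneg.2 has)
    rw [hL, sub_mul, div_mul_eq_mul_div, ← mul_div_assoc']
    linarith
  · have hL : L = V + (k - M) := by rw [← hyopt, min_eq_right (by linarith)]
    have hMpos : 0 < M := hk0.trans hMk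
    have h1 := hlp (k / M) (by positivity) ((div_le_one hMpos).2 hMk.le)
    rw [div_mul_cancel₀ _ hMpos.ne', sub_self, min_self, add_zero, hL, div_mul_eq_mul_div,
      div_le_iff₀ hMpos] at h1
    have hMV : M ≤ V := by nlinarith
    have hP := poisMin_mono k (mul_nonneg hs0 hk0.le) (mul_le_mul_of_nonneg_left hMk.le hs0)
    rw [hak] at hP
    have hdiv : s - a ≤ (s - a) / τ := le_div_self (sub_nonneg.2 has) hτ0 hτ1.le
    have hLk : 0 ≤ L := by linarith
    have h2 : (s - (s - a) / τ) * L ≤ a * L := mul_le_mul_of_nonneg_right (by linarith) hLk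
    have h3 := mul_le_mul_of_nonneg_right has (sub_nonneg.2 hMV)
    rw [hL] at h2 ⊢
    linarith
end

section
/- Let k ≥ 1 and n ≥ 1 be integers and p_1,…,p_n ∈ [0,1] with m := Σ_{i=1}^n p_i > k. Let B_1,…,B_n be independent Bernoulli random variables with P(B_i = 1) = p_i, and let B′_1,…,B′_n be independent Bernoulli random variables with P(B′_i = 1) = p_i · k/m. Then E[max(Σ_{i=1}^n B_i − k, 0)] − E[max(Σ_{i=1}^n B′_i − k, 0)] ≤ m − k. -/
open Finset

/-- The expectation of `f A`, where the random set `A ⊆ s` contains each `i ∈ s`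
independently with probability `p i`. -/
noncomputable def bernExpect {ι : Type*} [DecidableEq ι] (p : ι → ℝ) (s : Finset ι)
    (f : Finset ι → ℝ) : ℝ :=
  ∑ A ∈ s.powerset, ((∏ i ∈ A, p i) * ∏ i ∈ s \ A, (1 - p i)) * f A

section bernExpect

variable {ι : Type*} [DecidableEq ι]

/-- Condition on whether `a` belongs to the random set. -/
theorem bernExpect_insert (p : ι → ℝ) {s : Finset ι} {a : ι} (ha : a ∉ s)
    (f : Finset ι → ℝ) :
    bernExpect p (insert a s) f =
      bernExpect p s fun A => (1 - p a) * f A + p a * f (insert a A) := by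
  unfold bernExpect
  rw [sum_powerset_insert ha, ← sum_add_distrib]
  refine sum_congr rfl fun A hA => ?_
  have haA : a ∉ A := fun h => ha (mem_powerset.1 hA h)
  have h : a ∉ s \ A := fun h => ha (mem_sdiff.1 h).1
  rw [insert_sdiff_of_notMem s haA, prod_insert h, prod_insert haA,
    insert_sdiff_insert, sdiff_insert_of_notMem ha]
  ring

theorem bernExpect_congr (p : ι → ℝ) (s : Finset ι) {f g : Finset ι → ℝ}
    (h : ∀ A ⊆ s, f A = g A) : bernExpect p s f = bernExpect p s g :=
  sum_congr rfl fun A hA => by rw [h A (mem_powerset.1 hA)]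

theorem bernExpect_mono {p : ι → ℝ} (hp : ∀ i, p i ∈ Set.Icc (0 : ℝ) 1) (s : Finset ι)
    {f g : Finset ι → ℝ} (h : ∀ A, f A ≤ g A) : bernExpect p s f ≤ bernExpect p s g :=
  sum_le_sum fun A _ => mul_le_mul_of_nonneg_left (h A) <|
    mul_nonneg (prod_nonneg fun i _ => (hp i).1)
      (prod_nonneg fun i _ => sub_nonneg.2 (hp i).2)

theorem bernExpect_add (p : ι → ℝ) (s : Finset ι) (f g : Finset ι → ℝ) :
    bernExpect p s (fun A => f A + g A) = bernExpect p s f + bernExpect p s g := by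
  simp only [bernExpect, mul_add, sum_add_distrib]

theorem bernExpect_card_add (p : ι → ℝ) (s : Finset ι) (c : ℝ) :
    bernExpect p s (fun A => (A.card : ℝ) + c) = ∑ i ∈ s, p i + c := by
  induction s using Finset.induction_on generalizing c with
  | empty => simp [bernExpect]
  | insert a s ha ih =>
    rw [bernExpect_insert p ha, sum_insert ha,
      bernExpect_congr p s (g := fun A => (A.card : ℝ) + (p a + c)), ih]
    · ring
    · intro A hA
      rw [card_insert_of_notMem fun h => ha (hA h)]
      push_cast
      ring

/-- Stochastic monotonicity: raising the probabilities lowers the expectation of an antitone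
function of the random set. -/
theorem bernExpect_anti {p q : ι → ℝ} (hp : ∀ i, p i ∈ Set.Icc (0 : ℝ) 1)
    (hq : ∀ i, q i ∈ Set.Icc (0 : ℝ) 1) (hqp : ∀ i, q i ≤ p i) (s : Finset ι)
    {f : Finset ι → ℝ} (hf : Antitone f) : bernExpect p s f ≤ bernExpect q s f := by
  induction s using Finset.induction_on generalizing f with
  | empty => simp [bernExpect]
  | insert a s ha ih =>
    rw [bernExpect_insert p ha, bernExpect_insert q ha]
    refine (ih fun A B hAB => ?_).trans (bernExpect_mono hq s fun A => ?_)
    · exact add_le_add (mul_le_mul_of_nonneg_left (hf hAB) (sub_nonneg.2 (hp a).2))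
        (mul_le_mul_of_nonneg_left (hf (insert_subset_insert a hAB)) (hp a).1)
    · nlinarith [mul_nonneg (sub_nonneg.2 (hqp a)) (sub_nonneg.2 (hf (subset_insert a A)))]

end bernExpect

theorem sum_bernWeight_mul_max {n : ℕ} (p : Fin n → ℝ) (c : ℝ) :
    ∑ A : Finset (Fin n), bernWeight p A * max ((A.card : ℝ) - c) 0 =
      ∑ i, p i - c + bernExpect p univ fun A => max (c - (A.card : ℝ)) 0 := by
  rw [sub_eq_add_neg, ← bernExpect_card_add, ← bernExpect_add, bernExpect, powerset_univ]
  refine sum_congr rfl fun A _ => ?_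
  rw [bernWeight, compl_eq_univ_sdiff]
  congr 1
  rcases le_total (A.card : ℝ) c with h | h
  · rw [max_eq_right (by linarith), max_eq_left (by linarith)]
    ring
  · rw [max_eq_left (by linarith), max_eq_right (by linarith)]
    ring

/-- **Deflating acceptance probabilities (key inequality of Lemma: simul_easy_case).**
If `m = ∑ p i > k`, and `B_i`, `B'_i` are independent Bernoulli with means `p i` and
`p i * k / m` respectively, then
`E[max(∑ B_i − k, 0)] − E[max(∑ B'_i − k, 0)] ≤ m − k`. -/
theorem stmt10 (n k : ℕ) (hn : 0 < n) (hk : 0 < k)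
    (p : Fin n → ℝ) (hp : ∀ i, p i ∈ Set.Icc (0:ℝ) 1)
    (hm : (k:ℝ) < ∑ i, p i) :
    (∑ A : Finset (Fin n), bernWeight p A * max ((A.card : ℝ) - (k:ℝ)) 0)
      - (∑ A : Finset (Fin n),
          bernWeight (fun i => p i * ((k:ℝ) / ∑ i, p i)) A * max ((A.card : ℝ) - (k:ℝ)) 0)
    ≤ (∑ i, p i) - (k:ℝ) := by
  have hk0 : (0 : ℝ) ≤ k := k.cast_nonneg
  have hm0 : 0 < ∑ i, p i := hk0.trans_lt hm
  have hr0 : 0 ≤ (k : ℝ) / ∑ i, p i := div_nonneg hk0 hm0.le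
  have hr1 : (k : ℝ) / ∑ i, p i ≤ 1 := (div_le_one hm0).2 hm.le
  have hqp : ∀ i, p i * ((k : ℝ) / ∑ i, p i) ≤ p i :=
    fun i => mul_le_of_le_one_right (hp i).1 hr1
  have hanti : Antitone fun A : Finset (Fin n) => max ((k : ℝ) - (A.card : ℝ)) 0 :=
    fun A B hAB => max_le_max_right 0
      (sub_le_sub_left (Nat.cast_le.2 (card_le_card hAB)) _)
  have key := bernExpect_anti hp
    (fun i => ⟨mul_nonneg (hp i).1 hr0, (hqp i).trans (hp i).2⟩) hqp univ hanti
  rw [sum_bernWeight_mul_max, sum_bernWeight_mul_max, ← sum_mul, mul_div_cancel₀ _ hm0.ne']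
  linarith
end

section
/- Fix an integer k ≥ 1 and τ ∈ (0,1), and define f : [0,∞) → ℝ by f(s) = s − s/τ + (1/(τk)) Σ_{j=0}^∞ min(j, k) e^{−sk} (sk)^j / j!. Then: (i) f is concave on [0,∞); (ii) f is differentiable on (0,∞) with f′(s) = 1 − 1/τ + (1/τ) e^{−sk} Σ_{j=0}^{k−1} (sk)^j / j!; (iii) if s* ≥ 0 satisfies τ = 1 − e^{−s*k} Σ_{j=0}^{k−1} (s*k)^j / j!, then f(s*) = sup_{s ≥ 0} f(s) and f(min(s*, 1)) = sup_{0 ≤ s ≤ 1} f(s). -/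
open Finset

/-- The probability that a Poisson variable of rate `x` is less than `n`. -/
noncomputable def poisTail (n : ℕ) (x : ℝ) : ℝ :=
  Real.exp (-x) * ∑ j ∈ Finset.range n, x ^ j / (Nat.factorial j : ℝ)

theorem hasDerivAt_poisTail_succ (n : ℕ) (x : ℝ) :
    HasDerivAt (poisTail (n + 1)) (-(Real.exp (-x) * (x ^ n / (Nat.factorial n : ℝ)))) x := by
  have hexp : HasDerivAt (fun y : ℝ => Real.exp (-y)) (-Real.exp (-x)) x := by
    simpa using (hasDerivAt_neg x).exp
  induction n with
  | zero =>
    have hone : poisTail (0 + 1) = fun y => Real.exp (-y) := by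
      funext y
      simp [poisTail]
    simpa [hone] using hexp
  | succ n ih =>
    have hsplit : poisTail (n + 1 + 1) = fun y => poisTail (n + 1) y +
        Real.exp (-y) * (y ^ (n + 1) / (Nat.factorial (n + 1) : ℝ)) := by
      funext y
      simp only [poisTail, Finset.sum_range_succ _ (n + 1), mul_add]
    rw [hsplit]
    refine (ih.add (hexp.mul ((hasDerivAt_pow (n + 1) x).div_const _))).congr_deriv ?_
    have hn : (Nat.factorial n : ℝ) ≠ 0 := by positivity
    have hn' : (n : ℝ) + 1 ≠ 0 := by positivity
    simp only [Nat.factorial_succ, Nat.add_sub_cancel]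
    push_cast
    field_simp
    ring

theorem antitoneOn_poisTail (n : ℕ) : AntitoneOn (poisTail n) (Set.Ici 0) := by
  cases n with
  | zero => intro x _ y _ _; simp [poisTail]
  | succ n =>
    refine antitoneOn_of_hasDerivWithinAt_nonpos (convex_Ici 0)
      (fun x _ => (hasDerivAt_poisTail_succ n x).continuousAt.continuousWithinAt)
      (fun x _ => (hasDerivAt_poisTail_succ n x).hasDerivWithinAt) ?_
    intro x hx
    rw [interior_Ici] at hx
    have hx0 : 0 < x := hx
    exact neg_nonpos.mpr (by positivity)

theorem hasSum_poisson_weights (x : ℝ) :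
    HasSum (fun j : ℕ => Real.exp (-x) * x ^ j / (Nat.factorial j : ℝ)) 1 := by
  have h := (NormedSpace.expSeries_div_hasSum_exp x).mul_left (Real.exp (-x))
  rw [← Real.exp_eq_exp_ℝ, ← Real.exp_add, neg_add_cancel, Real.exp_zero] at h
  simpa only [mul_div_assoc] using h

theorem hasSum_min_mul_poisson_weights (k : ℕ) (x : ℝ) :
    HasSum (fun j : ℕ => min (j : ℝ) (k : ℝ) *
      (Real.exp (-x) * x ^ j / (Nat.factorial j : ℝ)))
      (∑ n ∈ Finset.range k, (1 - poisTail (n + 1) x)) := by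
  induction k with
  | zero => simp
  | succ k ih =>
    rw [Finset.sum_range_succ]
    have hfin : HasSum (fun j : ℕ => if j ∈ Finset.range (k + 1) then
        Real.exp (-x) * x ^ j / (Nat.factorial j : ℝ) else 0) (poisTail (k + 1) x) := by
      have h := hasSum_sum_of_ne_finset_zero (L := SummationFilter.unconditional ℕ)
        (s := Finset.range (k + 1))
        (f := fun j : ℕ => if j ∈ Finset.range (k + 1) then
          Real.exp (-x) * x ^ j / (Nat.factorial j : ℝ) else 0) (fun j hj => if_neg hj)
      convert h using 1
      rw [poisTail, Finset.mul_sum]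
      exact Finset.sum_congr rfl fun j hj => by rw [if_pos hj, mul_div_assoc]
    convert ih.add ((hasSum_poisson_weights x).sub hfin) using 2 with j
    by_cases hj : j < k + 1
    · have h1 : (j : ℝ) ≤ k := by exact_mod_cast Nat.lt_succ_iff.mp hj
      rw [if_pos (Finset.mem_range.mpr hj), min_eq_left h1, min_eq_left (by push_cast; linarith)]
      ring
    · have h1 : (k : ℝ) + 1 ≤ j := by exact_mod_cast not_lt.mp hj
      rw [if_neg (by simpa using hj), min_eq_right (by push_cast; linarith),
        min_eq_right (by linarith)]
      push_cast
      ring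

theorem hasDerivAt_poisMin (k : ℕ) (x : ℝ) : HasDerivAt (poisMin k) (poisTail k x) x := by
  have hclosed : poisMin k = fun y => ∑ n ∈ Finset.range k, (1 - poisTail (n + 1) y) :=
    funext fun y => (hasSum_min_mul_poisson_weights k y).tsum_eq
  rw [hclosed]
  refine (HasDerivAt.fun_sum fun n _ =>
    (hasDerivAt_poisTail_succ n x).const_sub 1).congr_deriv ?_
  simp [poisTail, Finset.mul_sum]

theorem hasDerivAt_poisMin_objective (k : ℕ) (hk : 0 < k) (τ s : ℝ) :
    HasDerivAt (fun s : ℝ => s - s/τ + (1/(τ*k)) * poisMin k (s*k))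
      (1 - 1/τ + (1/τ) * poisTail k (s*k)) s := by
  have hmul : HasDerivAt (fun s : ℝ => s * (k : ℝ)) k s := by
    simpa using (hasDerivAt_id s).mul_const (k : ℝ)
  have hk' : (k : ℝ) ≠ 0 := by positivity
  refine (((hasDerivAt_id s).sub ((hasDerivAt_id s).div_const τ)).add
    (((hasDerivAt_poisMin k (s * k)).comp s hmul).const_mul (1 / (τ * k)))).congr_deriv ?_
  field_simp

/-- **Properties of the objective defining `α_k^τ` and `β_k^τ` (Proposition: simul_foc).**
For `f(s) = s − s/τ + E[min(Pois(sk),k)]/(τk)`: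
(i) `f` is concave on `[0,∞)`;
(ii) `f′(s) = 1 − 1/τ + (1/τ) e^{−sk} ∑_{j<k} (sk)^j/j!` for `s > 0`;
(iii) any `s* ≥ 0` with `τ = 1 − e^{−s*k} ∑_{j<k} (s*k)^j/j!` maximizes `f` over `[0,∞)`,
and `min(s*,1)` maximizes `f` over `[0,1]`. -/
theorem stmt13 (k : ℕ) (hk : 0 < k) (τ : ℝ) (hτ : τ ∈ Set.Ioo (0:ℝ) 1) :
    ConcaveOn ℝ (Set.Ici (0:ℝ)) (fun s : ℝ => s - s/τ + (1/(τ*k)) * poisMin k (s*k)) ∧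
    (∀ s : ℝ, 0 < s →
      HasDerivAt (fun s : ℝ => s - s/τ + (1/(τ*k)) * poisMin k (s*k))
        (1 - 1/τ + (1/τ) * (Real.exp (-(s*k)) *
          ∑ j ∈ Finset.range k, (s*k)^j / (Nat.factorial j : ℝ))) s) ∧
    (∀ t : ℝ, 0 ≤ t →
      τ = 1 - Real.exp (-(t*k)) * ∑ j ∈ Finset.range k, (t*k)^j / (Nat.factorial j : ℝ) →
      ((fun s : ℝ => s - s/τ + (1/(τ*k)) * poisMin k (s*k)) t =
          sSup ((fun s : ℝ => s - s/τ + (1/(τ*k)) * poisMin k (s*k)) '' Set.Ici (0:ℝ)) ∧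
        (fun s : ℝ => s - s/τ + (1/(τ*k)) * poisMin k (s*k)) (min t 1) =
          sSup ((fun s : ℝ => s - s/τ + (1/(τ*k)) * poisMin k (s*k)) '' Set.Icc (0:ℝ) 1))) := by
  set f : ℝ → ℝ := fun s => s - s/τ + (1/(τ*k)) * poisMin k (s*k)
  have hτ0 : 0 < τ := hτ.1
  have hder : ∀ s, HasDerivAt f (1 - 1/τ + (1/τ) * poisTail k (s*k)) s :=
    hasDerivAt_poisMin_objective k hk τ
  have hcont : ∀ S : Set ℝ, ContinuousOn f S :=
    fun S s _ => (hder s).continuousAt.continuousWithinAt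
  have hanti : ∀ a b : ℝ, 0 ≤ a → a ≤ b →
      1 - 1/τ + (1/τ) * poisTail k (b*k) ≤ 1 - 1/τ + (1/τ) * poisTail k (a*k) := by
    intro a b ha hab
    have := antitoneOn_poisTail k (Set.mem_Ici.mpr (by positivity : 0 ≤ a * (k : ℝ)))
      (Set.mem_Ici.mpr (mul_nonneg (ha.trans hab) k.cast_nonneg)) (by gcongr)
    gcongr
  refine ⟨?_, fun s _ => hder s, ?_⟩
  · refine AntitoneOn.concaveOn_of_deriv (convex_Ici 0) (hcont _)
      (fun s _ => (hder s).differentiableAt.differentiableWithinAt) ?_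
    intro a ha b _ hab
    rw [(hder a).deriv, (hder b).deriv]
    exact hanti a b (interior_subset ha) hab
  intro t ht hteq
  have hzero : 1 - 1/τ + (1/τ) * poisTail k (t*k) = 0 := by
    have htail : poisTail k (t*k) = 1 - τ := by rw [poisTail]; linarith
    rw [htail]
    field_simp
    ring
  have hmono : MonotoneOn f (Set.Icc 0 t) := by
    refine monotoneOn_of_hasDerivWithinAt_nonneg (convex_Icc 0 t) (hcont _)
      (fun s _ => (hder s).hasDerivWithinAt) fun s hs => ?_
    have hs' := interior_subset hs
    exact hzero.symm.le.trans (hanti s t hs'.1 hs'.2)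
  have hanti' : AntitoneOn f (Set.Ici t) := by
    refine antitoneOn_of_hasDerivWithinAt_nonpos (convex_Ici t) (hcont _)
      (fun s _ => (hder s).hasDerivWithinAt) fun s hs => ?_
    exact (hanti t s ht (interior_subset hs)).trans hzero.le
  have hmax : ∀ s, 0 ≤ s → f s ≤ f t := by
    intro s hs
    rcases le_total s t with h | h
    · exact hmono ⟨hs, h⟩ ⟨ht, le_rfl⟩ h
    · exact hanti' Set.self_mem_Ici h h
  constructor
  · refine (IsGreatest.csSup_eq ⟨Set.mem_image_of_mem f (Set.mem_Ici.mpr ht), ?_⟩).symm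
    rintro _ ⟨s, hs, rfl⟩
    exact hmax s hs
  · refine (IsGreatest.csSup_eq ⟨Set.mem_image_of_mem f
      (Set.mem_Icc.mpr ⟨le_min ht zero_le_one, min_le_right t 1⟩), ?_⟩).symm
    rintro _ ⟨s, hs, rfl⟩
    rcases le_total t 1 with h | h
    · rw [min_eq_left h]
      exact hmax s hs.1
    · rw [min_eq_right h]
      exact hmono ⟨hs.1, hs.2.trans h⟩ ⟨zero_le_one, h⟩ hs.2
end

section
/- For every integer k ≥ 1, lim_{n→∞} Σ_{j=0}^n min(j, k) · C(n, j) · (k/n)^j · (1 − k/n)^{n−j} = k · (1 − e^{−k} k^k / k!), where C(n, j) denotes the binomial coefficient and the limit is taken over integers n ≥ k. -/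
open Filter

/-- The telescoping sum `∑_{j < m} (x - j) x^j / j! = m x^m / m!`. -/
lemma sum_range_sub_mul_pow_div_factorial (x : ℝ) (m : ℕ) :
    ∑ j ∈ Finset.range m, (x - j) * (x ^ j / (Nat.factorial j : ℝ)) =
      m * (x ^ m / (Nat.factorial m : ℝ)) := by
  induction m with
  | zero => simp
  | succ m ih =>
    rw [Finset.sum_range_succ, ih, Nat.factorial_succ]
    have := Nat.factorial_ne_zero m
    push_cast
    field_simp
    ring

/-- The mean of a binomial variable truncated at `k`, through its lower tail. -/
lemma sum_min_mul_binomial (k n : ℕ) (hkn : k ≤ n) (p : ℝ) :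
    ∑ j ∈ Finset.range (n + 1),
        ((min j k : ℕ) : ℝ) * (n.choose j : ℝ) * p ^ j * (1 - p) ^ (n - j) =
      k - ∑ j ∈ Finset.range k,
        ((k : ℝ) - j) * ((n.choose j : ℝ) * p ^ j * (1 - p) ^ (n - j)) := by
  have total : ∑ j ∈ Finset.range (n + 1),
      (n.choose j : ℝ) * p ^ j * (1 - p) ^ (n - j) = 1 := by
    have h := (add_pow p (1 - p) n).symm
    rw [add_sub_cancel, one_pow] at h
    exact (Finset.sum_congr rfl fun j _ => by ring).trans h
  have tail : ∑ j ∈ Finset.range k,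
        ((k : ℝ) - j) * ((n.choose j : ℝ) * p ^ j * (1 - p) ^ (n - j)) =
      ∑ j ∈ Finset.range (n + 1),
        ((k : ℝ) - (min j k : ℕ)) * ((n.choose j : ℝ) * p ^ j * (1 - p) ^ (n - j)) := by
    rw [← Finset.sum_subset (Finset.range_subset_range.2 (by omega : k ≤ n + 1))]
    · refine Finset.sum_congr rfl fun j hj => ?_
      rw [min_eq_left (Finset.mem_range.1 hj).le]
    · intro j _ hj
      rw [min_eq_right (by simpa using hj), sub_self, zero_mul]
  rw [tail]
  simp only [sub_mul, Finset.sum_sub_distrib]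
  rw [← Finset.mul_sum, total, mul_one, sub_sub_cancel]
  exact Finset.sum_congr rfl fun j _ => by ring

/-- **Binomial-to-Poisson limit for the tight ProbeTop-k instance (Proposition: ptk_ub).**
`E[min(Bin(n, k/n), k)] → k (1 − e^{−k} k^k / k!)` as `n → ∞`. -/
theorem stmt16 (k : ℕ) (hk : 0 < k) :
    Tendsto (fun n : ℕ => ∑ j ∈ Finset.range (n+1),
        ((min j k : ℕ) : ℝ) * (n.choose j : ℝ) * ((k:ℝ)/(n:ℝ))^j * (1 - (k:ℝ)/(n:ℝ))^(n-j))
      atTop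
      (nhds ((k:ℝ) * (1 - Real.exp (-(k:ℝ)) * (k:ℝ)^k / (Nat.factorial k : ℝ)))) := by
  have limit_eq : (k : ℝ) * (1 - Real.exp (-(k : ℝ)) * (k : ℝ) ^ k / (Nat.factorial k : ℝ)) =
      k - ∑ j ∈ Finset.range k,
        ((k : ℝ) - j) * (Real.exp (-(k : ℝ)) * (k : ℝ) ^ j / (Nat.factorial j : ℝ)) := by
    have h := sum_range_sub_mul_pow_div_factorial (k : ℝ) k
    simp only [mul_div_assoc, mul_left_comm _ (Real.exp _)]
    rw [← Finset.mul_sum, h]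
    ring
  have mean : Tendsto (fun n : ℕ => (n : ℝ) * ((k : ℝ) / n)) atTop (nhds (k : ℝ)) := by
    refine tendsto_const_nhds.congr' ?_
    filter_upwards [eventually_ne_atTop 0] with n hn
    field_simp
  rw [limit_eq]
  refine Tendsto.congr' ?_ (tendsto_const_nhds.sub (tendsto_finsetSum _ fun j _ =>
    (ProbabilityTheory.tendsto_choose_mul_pow_of_tendsto_mul_atTop j mean).const_mul _))
  filter_upwards [eventually_ge_atTop k] with n hn
  exact (sum_min_mul_binomial k n hn _).symm
end

section
/- Fix ε ∈ (0, 1/2) and consider the simultaneous offering instance with k = 1, n = 2, v_1 = ε, p_1 = ε, v_2 = ε(1−ε), p_2 = 1. For S ⊆ {1,2}, with B_1, B_2 independent Bernoulli random variables with P(B_i = 1) = p_i, define the simultaneous-offering reward R(S) := E[Σ_{i∈S} v_i B_i − max(Σ_{i∈S} B_i − 1, 0)]. Then R({1,2}) = 0, R({1}) = ε², and R({2}) = ε(1−ε); consequently max_{S⊆{1,2}} R(S) = ε(1−ε), and every value-ordered set S ∈ {∅, {1}, {1,2}} satisfies R(S) ≤ (ε/(1−ε)) · max_{S′⊆{1,2}}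 R(S′). -/
open Finset

theorem univ_finset_fin_two :
    (univ : Finset (Finset (Fin 2))) = {∅, {0}, {1}, {0, 1}} := by
  decide

theorem simReward_fin_two (k : ℕ) (p v : Fin 2 → ℝ) (S : Finset (Fin 2)) :
    simReward k p v S =
      p 0 * (1 - p 1) * ((∑ i ∈ S ∩ {0}, v i) - max (((S ∩ {0}).card : ℝ) - k) 0) +
      p 1 * (1 - p 0) * ((∑ i ∈ S ∩ {1}, v i) - max (((S ∩ {1}).card : ℝ) - k) 0) +
      p 0 * p 1 * ((∑ i ∈ S, v i) - max ((S.card : ℝ) - k) 0) := by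
  have h₀ : ({0} : Finset (Fin 2))ᶜ = {1} := by decide
  have h₁ : ({1} : Finset (Fin 2))ᶜ = {0} := by decide
  have h₂ : ({0, 1} : Finset (Fin 2)) = univ := by decide
  rw [simReward, univ_finset_fin_two, sum_insert (by decide), sum_insert (by decide),
    sum_insert (by decide), sum_singleton, h₂]
  simp only [bernWeight, h₀, h₁, compl_univ, inter_univ, inter_empty, sum_empty, card_empty,
    prod_singleton, prod_empty, Fin.prod_univ_two, Nat.cast_zero, zero_sub]
  rw [max_eq_right (neg_nonpos.mpr k.cast_nonneg)]
  ring

/-- With capacity one, the expected reward of a pair of candidates is the sum of their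
expected values minus the probability that both accept. -/
theorem simReward_one_pair (p v : Fin 2 → ℝ) :
    simReward 1 p v {0, 1} = p 0 * v 0 + p 1 * v 1 - p 0 * p 1 := by
  have h₀ : ({0, 1} : Finset (Fin 2)) ∩ {0} = {0} := by decide
  have h₁ : ({0, 1} : Finset (Fin 2)) ∩ {1} = {1} := by decide
  rw [simReward_fin_two, h₀, h₁]
  norm_num
  ring

/-- A single candidate never exceeds capacity one, so it earns its expected value. -/
theorem simReward_one_singleton (p v : Fin 2 → ℝ) (i : Fin 2) :
    simReward 1 p v {i} = p i * v i := by
  rw [simReward_fin_two]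
  fin_cases i <;> simp <;> ring

theorem simReward_empty {n : ℕ} (k : ℕ) (p v : Fin n → ℝ) : simReward k p v ∅ = 0 := by
  simp [simReward]

/-- **Value-ordered policies can be arbitrarily bad (Example: simul_VO).**
With `k = 1`, `n = 2`, `v₁ = p₁ = ε`, `v₂ = ε(1−ε)`, `p₂ = 1` (for `0 < ε < 1/2`):
`R({1,2}) = 0`, `R({1}) = ε²`, `R({2}) = ε(1−ε)`, the optimal reward is `ε(1−ε)`, and every
value-ordered set (`∅`, `{1}`, `{1,2}`) earns at most `ε/(1−ε)` times the optimum. -/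
theorem stmt17 (ε : ℝ) (hε : ε ∈ Set.Ioo (0:ℝ) (1/2)) :
    simReward 1 ![ε, 1] ![ε, ε*(1-ε)] ({0, 1} : Finset (Fin 2)) = 0 ∧
    simReward 1 ![ε, 1] ![ε, ε*(1-ε)] ({0} : Finset (Fin 2)) = ε^2 ∧
    simReward 1 ![ε, 1] ![ε, ε*(1-ε)] ({1} : Finset (Fin 2)) = ε*(1-ε) ∧
    (⨆ S : Finset (Fin 2), simReward 1 ![ε, 1] ![ε, ε*(1-ε)] S) = ε*(1-ε) ∧
    ∀ S ∈ ({∅, {0}, {0, 1}} : Set (Finset (Fin 2))),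
      simReward 1 ![ε, 1] ![ε, ε*(1-ε)] S ≤
        (ε/(1-ε)) * ⨆ S' : Finset (Fin 2), simReward 1 ![ε, 1] ![ε, ε*(1-ε)] S' := by
  obtain ⟨h0, h1⟩ := hε
  have hpair : simReward 1 ![ε, 1] ![ε, ε*(1-ε)] ({0, 1} : Finset (Fin 2)) = 0 := by
    rw [simReward_one_pair]
    simp
    ring
  have hfst : simReward 1 ![ε, 1] ![ε, ε*(1-ε)] ({0} : Finset (Fin 2)) = ε^2 := by
    rw [simReward_one_singleton]
    simp [sq]
  have hsnd : simReward 1 ![ε, 1] ![ε, ε*(1-ε)] ({1} : Finset (Fin 2)) = ε*(1-ε) := by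
    rw [simReward_one_singleton]
    simp
  have hempty := simReward_empty 1 ![ε, 1] ![ε, ε*(1-ε)]
  have hsup : (⨆ S : Finset (Fin 2), simReward 1 ![ε, 1] ![ε, ε*(1-ε)] S) = ε*(1-ε) := by
    refine le_antisymm (ciSup_le fun S => ?_)
      (hsnd.ge.trans (le_ciSup (f := simReward 1 ![ε, 1] ![ε, ε*(1-ε)])
        (Set.finite_range _).bddAbove {1}))
    have hS : S ∈ ({∅, {0}, {1}, {0, 1}} : Finset (Finset (Fin 2))) :=
      univ_finset_fin_two ▸ mem_univ S
    simp only [mem_insert, mem_singleton] at hS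
    rcases hS with rfl | rfl | rfl | rfl
    · rw [hempty]; nlinarith
    · rw [hfst]; nlinarith
    · exact hsnd.le
    · rw [hpair]; nlinarith
  refine ⟨hpair, hfst, hsnd, hsup, fun S hS => ?_⟩
  have hne : 1 - ε ≠ 0 := by linarith
  have hbound : ε/(1-ε) * (ε*(1-ε)) = ε^2 := by field_simp
  rw [hsup, hbound]
  rcases hS with rfl | rfl | rfl
  · rw [hempty]; positivity
  · exact hfst.le
  · rw [hpair]; positivity
end

section
/- There exists a random subset D of {1,2,3,4} — namely the one taking each of the eight values {1}, {2}, {3}, {4}, {1,2,3}, {1,2,4}, {1,3,4}, {2,3,4} with probability 1/8 — such that: (i) P(i ∈ D) = 1/2 for every i; (ii) D satisfies the negative correlation property: for every S ⊆ {1,2,3,4} and every b ∈ {0,1}, P(∀ i ∈ S, 1{i ∈ D} = b) ≤ Π_{i∈S} P(1{i ∈ D} = b); and (iii) E[min(|D|, 2)] = 3/2, whereas for the random subset D̃ that includes each of the four elements independently with probability 1/2 one has E[min(|D̃|, 2)] = 13/8 > 3/2. -/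
open Finset

/-- A real sum against the constant weight `c` on a finite family of sets, as a natural sum. -/
theorem sum_filter_ite_mem_mul {α : Type*} [Fintype α] [DecidableEq α] (T : Finset α) (c : ℝ)
    (P : α → Prop) [DecidablePred P] (f : α → ℕ) :
    ∑ A ∈ univ.filter P, (if A ∈ T then c else 0) * (f A : ℝ) =
      c * ((∑ A ∈ T.filter P, f A : ℕ) : ℝ) := by
  push_cast
  rw [mul_sum]
  simp only [ite_mul, zero_mul, ← sum_filter, filter_filter]
  congr 1
  ext A
  simp [and_comm]

theorem sum_filter_ite_mem {α : Type*} [Fintype α] [DecidableEq α] (T : Finset α) (c : ℝ)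
    (P : α → Prop) [DecidablePred P] :
    ∑ A ∈ univ.filter P, (if A ∈ T then c else 0) = c * ((T.filter P).card : ℝ) := by
  simpa using sum_filter_ite_mem_mul T c P (fun _ => 1)

theorem bernWeight_half {n : ℕ} (A : Finset (Fin n)) :
    bernWeight (fun _ => (1/2 : ℝ)) A = (1/2) ^ n := by
  have h : A.card + Aᶜ.card = n := by simp
  rw [bernWeight, prod_const, prod_const, show (1 - 1/2 : ℝ) = 1/2 by norm_num, ← pow_add, h]

/-- The sets of odd size in a four-element ground set. -/
def oddSets : Finset (Finset (Fin 4)) :=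
  {{0},{1},{2},{3},{0,1,2},{0,1,3},{0,2,3},{1,2,3}}

theorem eighth_mul_le_half_pow {m k : ℕ} (h : m * 2 ^ k ≤ 8) :
    (1/8 : ℝ) * m ≤ (1/2) ^ k := by
  have h' : (m : ℝ) * 2 ^ k ≤ 8 := by exact_mod_cast h
  rw [one_div_pow, le_div_iff₀ (by positivity)]
  linarith

/-- **Negative correlation can be beaten by independence for `k = 2`
(Example: negCorrelWorseThanIndep).**  The random subset `D` of `{1,2,3,4}` taking each of
the eight values `{1},{2},{3},{4},{1,2,3},{1,2,4},{1,3,4},{2,3,4}` with probability `1/8`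
has all marginals `1/2`, satisfies the negative correlation property for both `b = 1` and
`b = 0`, yet `E[min(|D|,2)] = 3/2 < 13/8 = E[min(|D̃|,2)]` where `D̃` includes each element
independently with probability `1/2`. -/
theorem stmt19 :
    ∃ μ : Finset (Fin 4) → ℝ,
      (∀ A, μ A = if A ∈ ({{0},{1},{2},{3},{0,1,2},{0,1,3},{0,2,3},{1,2,3}} :
          Finset (Finset (Fin 4))) then (1/8 : ℝ) else 0) ∧
      (∀ A, 0 ≤ μ A) ∧ (∑ A : Finset (Fin 4), μ A = 1) ∧
      (∀ i : Fin 4, ∑ A ∈ univ.filter (fun A : Finset (Fin 4) => i ∈ A), μ A = 1/2) ∧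
      (∀ S : Finset (Fin 4),
        (∑ A ∈ univ.filter (fun A : Finset (Fin 4) => ∀ i ∈ S, i ∈ A), μ A ≤
          ∏ i ∈ S, ∑ A ∈ univ.filter (fun A : Finset (Fin 4) => i ∈ A), μ A) ∧
        (∑ A ∈ univ.filter (fun A : Finset (Fin 4) => ∀ i ∈ S, i ∉ A), μ A ≤
          ∏ i ∈ S, ∑ A ∈ univ.filter (fun A : Finset (Fin 4) => i ∉ A), μ A)) ∧
      (∑ A : Finset (Fin 4), μ A * ((min A.card 2 : ℕ) : ℝ) = 3/2) ∧
      (∑ A : Finset (Fin 4), bernWeight (fun _ => (1/2 : ℝ)) A * ((min A.card 2 : ℕ) : ℝ)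
        = 13/8) ∧
      ((3:ℝ)/2 < 13/8) := by
  have hmem (i : Fin 4) : ∑ A ∈ univ.filter (fun A : Finset (Fin 4) => i ∈ A),
      (if A ∈ oddSets then (1/8 : ℝ) else 0) = 1/2 := by
    rw [sum_filter_ite_mem, (by decide : ∀ i : Fin 4,
      (oddSets.filter (fun A => i ∈ A)).card = 4) i]
    norm_num
  have hnot (i : Fin 4) : ∑ A ∈ univ.filter (fun A : Finset (Fin 4) => i ∉ A),
      (if A ∈ oddSets then (1/8 : ℝ) else 0) = 1/2 := by
    rw [sum_filter_ite_mem, (by decide : ∀ i : Fin 4,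
      (oddSets.filter (fun A => i ∉ A)).card = 4) i]
    norm_num
  refine ⟨fun A => if A ∈ oddSets then (1/8 : ℝ) else 0, fun A => rfl, fun A => ?_, ?_, hmem,
    fun S => ⟨?_, ?_⟩, ?_, ?_, by norm_num⟩
  · dsimp only
    split_ifs <;> norm_num
  · have h := sum_filter_ite_mem oddSets (1/8) (fun _ => True)
    rw [filter_true, filter_true, show oddSets.card = 8 by decide] at h
    rw [h]
    norm_num
  · simp only [hmem, prod_const]
    rw [sum_filter_ite_mem]
    exact eighth_mul_le_half_pow ((by decide : ∀ S : Finset (Fin 4),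
      (oddSets.filter (fun A => ∀ i ∈ S, i ∈ A)).card * 2 ^ S.card ≤ 8) S)
  · simp only [hnot, prod_const]
    rw [sum_filter_ite_mem]
    exact eighth_mul_le_half_pow ((by decide : ∀ S : Finset (Fin 4),
      (oddSets.filter (fun A => ∀ i ∈ S, i ∉ A)).card * 2 ^ S.card ≤ 8) S)
  · have h := sum_filter_ite_mem_mul oddSets (1/8) (fun _ => True) (fun A => min A.card 2)
    rw [filter_true, filter_true, show ∑ A ∈ oddSets, min A.card 2 = 12 by decide] at h
    rw [h]
    norm_num
  · simp only [bernWeight_half]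
    rw [← mul_sum, ← Nat.cast_sum,
      show ∑ A : Finset (Fin 4), min A.card 2 = 26 by decide]
    norm_num
end
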